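/- arXiv:2110.03957 — 8 statements merged into one kernel-verified Lean document; each statement's English description precedes it below -/
import Mathlib

section
/- Let c ∈ (0,1) be a constant and let p : ℕ → [0,1] be a function with p(n)·n^{7/6} → ∞ as n → ∞ and p(n) ≤ c/n for all n. Then asymptotically almost surely the random graph G(n, p(n)) has twin-width exactly 2. -/
/-- A trigraph: a finite vertex set together with disjoint symmetric sets of
black and red edges on distinct vertices. -/
structure Trigraph (V : Type*) where
  verts : Finset V
  Black : V → V → Prop
  Red : V → V → Prop
  black_symm : ∀ u v, Black u v → Black v u
  red_symm : ∀ u v, Red u v → Red v u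
  black_ne : ∀ u v, Black u v → u ≠ v
  red_ne : ∀ u v, Red u v → u ≠ v
  black_red_disjoint : ∀ u v, ¬(Black u v ∧ Red u v)
  black_mem : ∀ u v, Black u v → u ∈ verts
  red_mem : ∀ u v, Red u v → u ∈ verts

namespace Trigraph

variable {V : Type*}

/-- Two vertices are adjacent if they are joined by a black or a red edge. -/
def Adj (G : Trigraph V) (u v : V) : Prop := G.Black u v ∨ G.Red u v

/-- The red-degree of a vertex: the number of red edges incident with it. -/
noncomputable def redDeg (G : Trigraph V) (v : V) : ℕ := {w | G.Red v w}.ncard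

/-- The degree of a vertex: the number of (black or red) edges incident with it. -/
noncomputable def deg (G : Trigraph V) (v : V) : ℕ := {w | G.Adj v w}.ncard

/-- Contraction of the two distinct vertices `u` and `v` of `G`; the new vertex is
identified with `u`. A pair keeps a black edge to the new vertex iff it had black
edges to both `u` and `v`; it is non-adjacent iff it was non-adjacent to both;
otherwise it gets a red edge. -/
def contract [DecidableEq V] (G : Trigraph V) (u v : V) : Trigraph V where
  verts := G.verts.erase v
  Black x y := x ∈ G.verts.erase v ∧ y ∈ G.verts.erase v ∧ x ≠ y ∧
    ((x = u ∧ G.Black u y ∧ G.Black v y) ∨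
     (y = u ∧ G.Black u x ∧ G.Black v x) ∨
     (x ≠ u ∧ y ≠ u ∧ G.Black x y))
  Red x y := x ∈ G.verts.erase v ∧ y ∈ G.verts.erase v ∧ x ≠ y ∧
    ((x = u ∧ (G.Adj u y ∨ G.Adj v y) ∧ ¬(G.Black u y ∧ G.Black v y)) ∨
     (y = u ∧ (G.Adj u x ∨ G.Adj v x) ∧ ¬(G.Black u x ∧ G.Black v x)) ∨
     (x ≠ u ∧ y ≠ u ∧ G.Red x y))
  black_symm := by
    rintro x y ⟨hx, hy, hxy, h⟩
    refine ⟨hy, hx, hxy.symm, ?_⟩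
    rcases h with h | h | ⟨h1, h2, h3⟩
    · exact Or.inr (Or.inl h)
    · exact Or.inl h
    · exact Or.inr (Or.inr ⟨h2, h1, G.black_symm _ _ h3⟩)
  red_symm := by
    rintro x y ⟨hx, hy, hxy, h⟩
    refine ⟨hy, hx, hxy.symm, ?_⟩
    rcases h with h | h | ⟨h1, h2, h3⟩
    · exact Or.inr (Or.inl h)
    · exact Or.inl h
    · exact Or.inr (Or.inr ⟨h2, h1, G.red_symm _ _ h3⟩)
  black_ne := fun _ _ h => h.2.2.1
  red_ne := fun _ _ h => h.2.2.1
  black_red_disjoint := by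
    rintro x y ⟨⟨hx, hy, hxy, hb⟩, ⟨_, _, _, hr⟩⟩
    rcases hb with ⟨hxu, hb1, hb2⟩ | ⟨hyu, hb1, hb2⟩ | ⟨hxu, hyu, hb⟩ <;>
      rcases hr with ⟨hxu', hr1, hr2⟩ | ⟨hyu', hr1, hr2⟩ | ⟨hxu', hyu', hr⟩
    · exact hr2 ⟨hb1, hb2⟩
    · exact hxy (hxu.trans hyu'.symm)
    · exact hxu' hxu
    · exact hxy (hxu'.trans hyu.symm)
    · exact hr2 ⟨hb1, hb2⟩
    · exact hyu' hyu
    · exact hxu hxu'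
    · exact hyu hyu'
    · exact G.black_red_disjoint x y ⟨hb, hr⟩
  black_mem := fun _ _ h => h.1
  red_mem := fun _ _ h => h.1

/-- `G.ValidSeq L` asserts that the list `L` of pairs of vertices describes a
sequence of valid contractions starting from `G`: at each step, both vertices are
distinct vertices of the current trigraph, which are then contracted. -/
def ValidSeq [DecidableEq V] : Trigraph V → List (V × V) → Prop
  | _, [] => True
  | G, p :: L => p.1 ∈ G.verts ∧ p.2 ∈ G.verts ∧ p.1 ≠ p.2 ∧ ValidSeq (G.contract p.1 p.2) L

/-- The trigraph obtained after performing the contractions listed in `L`. -/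
def applySeq [DecidableEq V] (G : Trigraph V) (L : List (V × V)) : Trigraph V :=
  L.foldl (fun H p => H.contract p.1 p.2) G

/-- The twin-width of a trigraph: the least `d` admitting a contraction sequence to a
one-vertex trigraph in which every intermediate trigraph has maximum red-degree at most `d`. -/
noncomputable def tww [DecidableEq V] (G : Trigraph V) : ℕ :=
  sInf {d : ℕ | ∃ L : List (V × V), G.ValidSeq L ∧ (G.applySeq L).verts.card = 1 ∧
    ∀ L' : List (V × V), L' <+: L → ∀ v, (G.applySeq L').redDeg v ≤ d}

/-- The map induced by a partial contraction sequence, sending each vertex of the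
initial trigraph to the vertex of the final trigraph into which it is contracted. -/
def seqMap [DecidableEq V] (L : List (V × V)) (x : V) : V :=
  L.foldl (fun y p => if y = p.2 then p.1 else y) x

/-- `δ_G(A)`: the set of edges of `G` with one end in `A` and the other end not in `A`. -/
def cut (G : Trigraph V) (A : Set V) : Set (Sym2 V) :=
  {e | ∃ x y, e = s(x, y) ∧ G.Adj x y ∧ x ∈ A ∧ y ∉ A}

end Trigraph

/-- A simple graph viewed as a trigraph with all edges black and no red edges. -/
def SimpleGraph.toTrigraph {V : Type*} [Fintype V] (G : SimpleGraph V) : Trigraph V where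
  verts := Finset.univ
  Black := G.Adj
  Red _ _ := False
  black_symm := fun _ _ h => h.symm
  red_symm := fun _ _ h => h.elim
  black_ne := fun _ _ h => h.ne
  red_ne := fun _ _ h => h.elim
  black_red_disjoint := fun _ _ h => h.2
  black_mem := fun _ _ _ => Finset.mem_univ _
  red_mem := fun _ _ h => h.elim

/-- The twin-width of a simple graph. -/
noncomputable def SimpleGraph.tww {V : Type*} [Fintype V] [DecidableEq V]
    (G : SimpleGraph V) : ℕ :=
  G.toTrigraph.tww

/-- The probability, under the Erdős–Rényi random graph `G(n,p)` on vertex set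
`Fin n`, of the event `A`: each graph `G` occurs with probability
`p^{e(G)} (1-p)^{C(n,2)-e(G)}`. -/
noncomputable def erProb (n : ℕ) (p : ℝ) (A : Set (SimpleGraph (Fin n))) : ℝ :=
  ∑ᶠ G ∈ A, p ^ G.edgeSet.ncard * (1 - p) ^ (n.choose 2 - G.edgeSet.ncard)

namespace TwwAux
open Trigraph

section upper
variable {V : Type*} [Fintype V] [DecidableEq V]

def W2 (H : Trigraph V) : Prop := ∃ L : List (V × V), H.ValidSeq L ∧
  (H.applySeq L).verts.card = 1 ∧
  ∀ L' : List (V × V), L' <+: L → ∀ v, (H.applySeq L').redDeg v ≤ 2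

lemma W2.base {H : Trigraph V} (h1 : H.verts.card = 1) (hd : ∀ v, H.redDeg v ≤ 2) : W2 H := by
  refine ⟨[], trivial, h1, ?_⟩
  intro L' hL' v
  rw [List.prefix_nil] at hL'
  subst hL'
  exact hd v

lemma W2.step {H : Trigraph V} {u v : V} (hu : u ∈ H.verts) (hv : v ∈ H.verts) (huv : u ≠ v)
    (hd : ∀ v, H.redDeg v ≤ 2) (hW : W2 (H.contract u v)) : W2 H := by
  obtain ⟨L, h1, h2, h3⟩ := hW
  refine ⟨(u, v) :: L, ⟨hu, hv, huv, h1⟩, h2, ?_⟩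
  intro L' hL' w
  rcases L' with _ | ⟨a, L'⟩
  · exact hd w
  · rw [List.cons_prefix_cons] at hL'
    obtain ⟨rfl, hL'⟩ := hL'
    exact h3 L' hL' w

lemma adj_mem {H : Trigraph V} {x y : V} (h : H.Adj x y) : x ∈ H.verts ∧ y ∈ H.verts ∧ x ≠ y := by
  rcases h with h | h
  · exact ⟨H.black_mem _ _ h, H.black_mem _ _ (H.black_symm _ _ h), H.black_ne _ _ h⟩
  · exact ⟨H.red_mem _ _ h, H.red_mem _ _ (H.red_symm _ _ h), H.red_ne _ _ h⟩

lemma adj_symm {H : Trigraph V} {x y : V} (h : H.Adj x y) : H.Adj y x := by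
  rcases h with h | h
  · exact Or.inl (H.black_symm _ _ h)
  · exact Or.inr (H.red_symm _ _ h)

lemma red_contract {H : Trigraph V} {u v x y : V} (h : (H.contract u v).Red x y) :
    x ∈ H.verts ∧ y ∈ H.verts ∧ x ≠ v ∧ y ≠ v ∧ x ≠ y ∧
    ((x = u ∧ (H.Adj u y ∨ H.Adj v y)) ∨ (y = u ∧ (H.Adj u x ∨ H.Adj v x)) ∨
     (x ≠ u ∧ y ≠ u ∧ H.Red x y)) := by
  obtain ⟨hx, hy, hxy, h⟩ := h
  rw [Finset.mem_erase] at hx hy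
  refine ⟨hx.2, hy.2, hx.1, hy.1, hxy, ?_⟩
  tauto

lemma adj_contract {H : Trigraph V} {u v x y : V} (h : (H.contract u v).Adj x y) :
    x ∈ H.verts ∧ y ∈ H.verts ∧ x ≠ v ∧ y ≠ v ∧ x ≠ y ∧
    ((x = u ∧ (H.Adj u y ∨ H.Adj v y)) ∨ (y = u ∧ (H.Adj u x ∨ H.Adj v x)) ∨
     (x ≠ u ∧ y ≠ u ∧ H.Adj x y)) := by
  rcases h with h | h
  · obtain ⟨hx, hy, hxy, h⟩ := h
    rw [Finset.mem_erase] at hx hy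
    refine ⟨hx.2, hy.2, hx.1, hy.1, hxy, ?_⟩
    unfold Trigraph.Adj
    tauto
  · have := red_contract h
    unfold Trigraph.Adj at *
    tauto

lemma redDeg_le_two {H : Trigraph V} {v : V} (a : V) (P : V → Prop)
    (hP : ∀ w w', P w → P w' → w = w') (h : ∀ w, H.Red v w → w = a ∨ P w) : H.redDeg v ≤ 2 := by
  unfold Trigraph.redDeg
  have h1 : {w | H.Red v w} ⊆ insert a {w | P w} := fun w hw => by
    rcases h w hw with h | h
    · exact Or.inl h
    · exact Or.inr h
  have h2 : ({w | P w} : Set V).ncard ≤ 1 := by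
    rw [Set.ncard_le_one (Set.toFinite _)]
    intro a ha b hb
    exact hP a b ha hb
  have h3 := Set.ncard_le_ncard h1 (Set.toFinite _)
  have h4 := Set.ncard_insert_le a {w | P w}
  omega

lemma redDeg_mono {H K : Trigraph V} {v : V} (h : ∀ w, K.Red v w → H.Red v w) :
    K.redDeg v ≤ H.redDeg v := Set.ncard_le_ncard h (Set.toFinite _)

def Leaf (H : Trigraph V) (f : V → V) (x : V) : Prop := ∀ w ∈ H.verts, f w ≠ x

structure Ph1 (H : Trigraph V) (f : V → V) : Prop where
  ne : H.verts.Nonempty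
  map : ∀ x ∈ H.verts, f x ∈ H.verts
  adj : ∀ x y, H.Adj x y → f x = y ∨ f y = x
  red : ∀ x y, H.Red x y → (f x = y ∧ Leaf H f x) ∨ (f y = x ∧ Leaf H f y)
  deg : ∀ v, H.redDeg v ≤ 2

structure Ph2 (H : Trigraph V) (f : V → V) (C : Finset V) (h : V) : Prop where
  sub : C ⊆ H.verts
  hub : h ∈ C
  map : ∀ x ∈ H.verts, f x ∈ C
  inj : ∀ x ∈ C, ∀ y ∈ C, f x = f y → x = y
  injL : ∀ x ∈ H.verts, ∀ y ∈ H.verts, x ∉ C → y ∉ C → f x = f y → x = y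
  nop : ∀ x ∈ H.verts, x ∉ C → f x ≠ h
  adj : ∀ x y, H.Adj x y → f x = y ∨ f y = x
  red : ∀ x y, H.Red x y → (f x = y ∧ x ∉ C) ∨ (f y = x ∧ y ∉ C) ∨ x = h ∨ y = h

lemma Ph2.deg {H : Trigraph V} {f : V → V} {C : Finset V} {h : V} (P : Ph2 H f C h) (v : V) :
    H.redDeg v ≤ 2 := by
  by_cases hv : v = h
  · subst hv
    refine redDeg_le_two (f v) (fun w => w ∈ C ∧ f w = v) ?_ ?_
    · rintro w w' ⟨h1, h2⟩ ⟨h3, h4⟩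
      exact P.inj _ h1 _ h3 (h2.trans h4.symm)
    · intro w hw
      rcases P.adj _ _ (Or.inr hw) with h1 | h1
      · exact Or.inl h1.symm
      · refine Or.inr ⟨?_, h1⟩
        by_contra hc
        exact P.nop w (adj_mem (Or.inr hw)).2.1 hc h1
  · by_cases hvC : v ∈ C
    · refine redDeg_le_two h (fun w => w ∈ H.verts ∧ w ∉ C ∧ f w = v) ?_ ?_
      · rintro w w' ⟨h1, h2, h3⟩ ⟨h4, h5, h6⟩
        exact P.injL _ h1 _ h4 h2 h5 (h3.trans h6.symm)
      · intro w hw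
        have := P.red _ _ hw
        have := (adj_mem (H := H) (Or.inr hw)).2.1
        tauto
    · refine redDeg_le_two (f v) (fun _ => False) (by tauto) ?_
      intro w hw
      rcases P.adj _ _ (Or.inr hw) with h1 | h1
      · exact Or.inl h1.symm
      · exact absurd (h1 ▸ P.map w (adj_mem (H := H) (Or.inr hw)).2.1) hvC

lemma Ph1.stepA {H : Trigraph V} {f : V → V} (P : Ph1 H f) {x y : V} (hx : x ∈ H.verts)
    (hy : y ∈ H.verts) (hxy : x ≠ y) (lx : Leaf H f x) (ly : Leaf H f y) (hf : f x = f y)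
    (hr : H.Red (f x) x ∨ H.redDeg (f x) ≤ 1) : Ph1 (H.contract x y) f := by
  have key : ∀ b, (H.Adj x b ∨ H.Adj y b) → f x = b := by
    rintro b (h | h)
    · rcases P.adj _ _ h with h1 | h1
      · exact h1
      · exact absurd h1 (lx b (adj_mem h).2.1)
    · rcases P.adj _ _ h with h1 | h1
      · exact hf.trans h1
      · exact absurd h1 (ly b (adj_mem h).2.1)
  have leaf : ∀ a, Leaf H f a → Leaf (H.contract x y) f a := fun a ha w hw =>
    ha w (Finset.mem_of_mem_erase hw)
  refine ⟨⟨x, Finset.mem_erase.2 ⟨hxy, hx⟩⟩, ?_, ?_, ?_, ?_⟩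
  · intro w hw
    have hw := Finset.mem_of_mem_erase hw
    exact Finset.mem_erase.2 ⟨ly w hw, P.map w hw⟩
  · intro a b hab
    obtain ⟨ha, hb, hay, hby, hne, h | h | h⟩ := adj_contract hab
    · rw [h.1]; exact Or.inl (key b h.2)
    · rw [h.1]; exact Or.inr (key a h.2)
    · exact P.adj _ _ h.2.2
  · intro a b hab
    obtain ⟨ha, hb, hay, hby, hne, h | h | h⟩ := red_contract hab
    · rw [h.1]; exact Or.inl ⟨key b h.2, leaf _ lx⟩
    · rw [h.1]; exact Or.inr ⟨key a h.2, leaf _ lx⟩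
    · rcases P.red _ _ h.2.2 with h | h
      · exact Or.inl ⟨h.1, leaf _ h.2⟩
      · exact Or.inr ⟨h.1, leaf _ h.2⟩
  · intro v
    by_cases hvx : v = x
    · refine redDeg_le_two (f x) (fun _ => False) (by tauto) ?_
      intro w hw
      obtain ⟨ha, hb, hay, hby, hne, h | h | h⟩ := red_contract hw
      · exact Or.inl (key w h.2).symm
      · exact absurd (hvx.trans h.1.symm) hne
      · exact absurd hvx h.1
    · have hsub : ∀ w, (H.contract x y).Red v w → (w = x ∧ v = f x) ∨ H.Red v w := by
        intro w hw
        obtain ⟨ha, hb, hay, hby, hne, h | h | h⟩ := red_contract hw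
        · exact absurd h.1 hvx
        · exact Or.inl ⟨h.1, (key v h.2).symm⟩
        · exact Or.inr h.2.2
      by_cases hvz : v = f x
      · rcases hr with hr | hr
        · refine (redDeg_mono (H := H) ?_).trans (P.deg v)
          intro w hw
          rcases hsub w hw with h | h
          · rw [h.1, h.2]; exact hr
          · exact h
        · have h1 : {w | (H.contract x y).Red v w} ⊆ insert x {w | H.Red v w} := fun w hw => by
            rcases hsub w hw with h | h
            · exact Or.inl h.1
            · exact Or.inr h
          have h3 := Set.ncard_le_ncard h1 (Set.toFinite _)
          have h4 := Set.ncard_insert_le x {w | H.Red v w}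
          rw [← hvz] at hr
          unfold Trigraph.redDeg at hr ⊢
          omega
      · refine (redDeg_mono (H := H) ?_).trans (P.deg v)
        intro w hw
        rcases hsub w hw with h | h
        · exact absurd h.2 hvz
        · exact h

lemma Ph1.stepB {H : Trigraph V} {f : V → V} (P : Ph1 H f) {z y : V} (hz : z ∈ H.verts)
    (hy : y ∈ H.verts) (hf : f y = z) (ly : Leaf H f y)
    (hone : ∀ w ∈ H.verts, f w = z → w = y)
    (hall : ∀ a ∈ H.verts, ∀ b ∈ H.verts, Leaf H f a → Leaf H f b → f a = f b → a = b) :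
    Ph1 (H.contract z y) f := by
  have hzy : z ≠ y := fun h => ly y hy (hf.trans h)
  have key : ∀ b, b ≠ y → b ≠ z → (H.Adj z b ∨ H.Adj y b) → f z = b := by
    rintro b hb hbz (h | h)
    · rcases P.adj _ _ h with h1 | h1
      · exact h1
      · exact absurd (hone b (adj_mem h).2.1 h1) hb
    · rcases P.adj _ _ h with h1 | h1
      · exact absurd (h1.symm.trans hf) hbz
      · exact absurd h1 (ly b (adj_mem h).2.1)
  have leaf : ∀ a, Leaf H f a → Leaf (H.contract z y) f a := fun a ha w hw =>
    ha w (Finset.mem_of_mem_erase hw)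
  have lz : Leaf (H.contract z y) f z := by
    intro w hw h
    have hw := Finset.mem_erase.1 hw
    exact hw.1 (hone w hw.2 h)
  refine ⟨⟨z, Finset.mem_erase.2 ⟨hzy, hz⟩⟩, ?_, ?_, ?_, ?_⟩
  · intro w hw
    have hw := Finset.mem_of_mem_erase hw
    exact Finset.mem_erase.2 ⟨ly w hw, P.map w hw⟩
  · intro a b hab
    obtain ⟨ha, hb, hay, hby, hne, h | h | h⟩ := adj_contract hab
    · rw [h.1] at hne ⊢; exact Or.inl (key b hby hne.symm h.2)
    · rw [h.1] at hne ⊢; exact Or.inr (key a hay hne h.2)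
    · exact P.adj _ _ h.2.2
  · intro a b hab
    obtain ⟨ha, hb, hay, hby, hne, h | h | h⟩ := red_contract hab
    · rw [h.1] at hne ⊢; exact Or.inl ⟨key b hby hne.symm h.2, lz⟩
    · rw [h.1] at hne ⊢; exact Or.inr ⟨key a hay hne h.2, lz⟩
    · rcases P.red _ _ h.2.2 with h | h
      · exact Or.inl ⟨h.1, leaf _ h.2⟩
      · exact Or.inr ⟨h.1, leaf _ h.2⟩
  · intro v
    by_cases hvx : v = z
    · refine redDeg_le_two (f z) (fun _ => False) (by tauto) ?_
      intro w hw
      obtain ⟨ha, hb, hay, hby, hne, h | h | h⟩ := red_contract hw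
      · exact Or.inl (key w hby (hvx ▸ hne.symm) h.2).symm
      · exact absurd (hvx.trans h.1.symm) hne
      · exact absurd hvx h.1
    · have hsub : ∀ w, (H.contract z y).Red v w → (w = z ∧ v = f z) ∨ H.Red v w := by
        intro w hw
        obtain ⟨ha, hb, hay, hby, hne, h | h | h⟩ := red_contract hw
        · exact absurd h.1 hvx
        · exact Or.inl ⟨h.1, (key v hay hvx h.2).symm⟩
        · exact Or.inr h.2.2
      by_cases hvz : v = f z
      · refine redDeg_le_two z (fun w => w ∈ H.verts ∧ Leaf H f w ∧ f w = v) ?_ ?_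
        · rintro w w' ⟨h1, h2, h3⟩ ⟨h4, h5, h6⟩
          exact hall _ h1 _ h4 h2 h5 (h3.trans h6.symm)
        · intro w hw
          rcases hsub w hw with h | h
          · exact Or.inl h.1
          · right
            rcases P.red _ _ h with h' | h'
            · exact absurd hvz.symm (h'.2 z hz)
            · exact ⟨(adj_mem (H := H) (Or.inr h)).2.1, h'.2, h'.1⟩
      · refine (redDeg_mono (H := H) ?_).trans (P.deg v)
        intro w hw
        rcases hsub w hw with h | h
        · exact absurd h.2 hvz
        · exact h

lemma Ph2.step1 {H : Trigraph V} {f : V → V} {C : Finset V} {h : V} (P : Ph2 H f C h) {l : V}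
    (hlC : l ∉ C) (hl : ∀ b, H.Adj l b → b ≠ h → f h = b) :
    Ph2 (H.contract h l) f C h := by
  refine ⟨?_, P.hub, ?_, P.inj, ?_, ?_, ?_, ?_⟩
  · intro x hx
    exact Finset.mem_erase.2 ⟨fun h => hlC (h ▸ hx), P.sub hx⟩
  · intro x hx
    exact P.map x (Finset.mem_of_mem_erase hx)
  · intro x hx y hy
    exact P.injL x (Finset.mem_of_mem_erase hx) y (Finset.mem_of_mem_erase hy)
  · intro x hx
    exact P.nop x (Finset.mem_of_mem_erase hx)
  · intro a b hab
    obtain ⟨ha, hb, hay, hby, hne, h | h | h⟩ := adj_contract hab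
    · rw [h.1] at hne ⊢
      rcases h.2 with h | h
      · exact P.adj _ _ h
      · exact Or.inl (hl b h hne.symm)
    · rw [h.1] at hne ⊢
      rcases h.2 with h | h
      · exact (P.adj _ _ h).symm
      · exact Or.inr (hl a h hne)
    · exact P.adj _ _ h.2.2
  · intro a b hab
    obtain ⟨ha, hb, hay, hby, hne, h | h | h⟩ := red_contract hab
    · tauto
    · tauto
    · exact P.red _ _ h.2.2

lemma Ph2.step2 {H : Trigraph V} {f : V → V} {C : Finset V} {h : V} (P : Ph2 H f C h)
    (hw : f h ≠ h) (hn : ∀ x ∈ H.verts, x ∉ C → f x ≠ f h) :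
    Ph2 (H.contract h (f h)) (Function.update f h (f (f h))) (C.erase (f h)) h := by
  have hV := P.sub P.hub
  have hfC := P.map h hV
  have uniq : ∀ x ∈ H.verts, f x = f h → x = h := by
    intro x hx hxe
    by_cases hxC : x ∈ C
    · exact P.inj _ hxC _ P.hub hxe
    · exact absurd hxe (hn x hx hxC)
  have key : ∀ b, b ≠ f h → b ≠ h → (H.Adj h b ∨ H.Adj (f h) b) →
      Function.update f h (f (f h)) h = b ∨ Function.update f h (f (f h)) b = h := by
    intro b hb hbh hab
    rw [Function.update_self, Function.update_of_ne hbh]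
    rcases hab with hab | hab
    · rcases P.adj _ _ hab with h1 | h1
      · exact absurd h1.symm hb
      · exact Or.inr h1
    · rcases P.adj _ _ hab with h1 | h1
      · exact Or.inl h1
      · exact absurd (uniq b (adj_mem hab).2.1 h1) hbh
  refine ⟨Finset.erase_subset_erase _ P.sub, Finset.mem_erase.2 ⟨hw.symm, P.hub⟩, ?_, ?_, ?_, ?_, ?_, ?_⟩
  · intro x hx
    have hx := Finset.mem_erase.1 hx
    by_cases hxh : x = h
    · subst hxh
      rw [Function.update_self]
      exact Finset.mem_erase.2 ⟨fun he => hw (uniq _ (P.sub hfC) he), P.map _ (P.sub hfC)⟩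
    · rw [Function.update_of_ne hxh]
      exact Finset.mem_erase.2 ⟨fun he => hxh (uniq _ hx.2 he), P.map _ hx.2⟩
  · intro x hx y hy hxy
    have hx := Finset.mem_erase.1 hx
    have hy := Finset.mem_erase.1 hy
    by_cases hxh : x = h <;> by_cases hyh : y = h
    · rw [hxh, hyh]
    · rw [hxh, Function.update_self, Function.update_of_ne hyh] at hxy
      exact absurd (P.inj _ hfC _ hy.2 hxy).symm hy.1
    · rw [hyh, Function.update_self, Function.update_of_ne hxh] at hxy
      exact absurd (P.inj _ hx.2 _ hfC hxy) hx.1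
    · rw [Function.update_of_ne hxh, Function.update_of_ne hyh] at hxy
      exact P.inj _ hx.2 _ hy.2 hxy
  · intro x hx y hy hxC hyC hxy
    have hx := Finset.mem_erase.1 hx
    have hy := Finset.mem_erase.1 hy
    have hxC : x ∉ C := fun h => hxC (Finset.mem_erase.2 ⟨hx.1, h⟩)
    have hyC : y ∉ C := fun h => hyC (Finset.mem_erase.2 ⟨hy.1, h⟩)
    rw [Function.update_of_ne (show x ≠ h from fun he => hxC (he ▸ P.hub)),
      Function.update_of_ne (show y ≠ h from fun he => hyC (he ▸ P.hub))] at hxy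
    exact P.injL _ hx.2 _ hy.2 hxC hyC hxy
  · intro x hx hxC
    have hx := Finset.mem_erase.1 hx
    have hxC : x ∉ C := fun h => hxC (Finset.mem_erase.2 ⟨hx.1, h⟩)
    rw [Function.update_of_ne (show x ≠ h from fun he => hxC (he ▸ P.hub))]
    exact P.nop x hx.2 hxC
  · intro a b hab
    obtain ⟨ha, hb, hay, hby, hne, h | h | h⟩ := adj_contract hab
    · rw [h.1] at hne ⊢
      exact key b hby hne.symm h.2
    · rw [h.1] at hne ⊢
      exact (key a hay hne h.2).symm
    · rw [Function.update_of_ne h.1, Function.update_of_ne h.2.1]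
      exact P.adj _ _ h.2.2
  · intro a b hab
    obtain ⟨ha, hb, hay, hby, hne, h | h | h⟩ := red_contract hab
    · tauto
    · tauto
    · rw [Function.update_of_ne h.1, Function.update_of_ne h.2.1]
      have := P.red _ _ h.2.2
      simp only [Finset.mem_erase]
      tauto

lemma Ph2.toPh1 {H : Trigraph V} {f : V → V} {C : Finset V} {h : V} (P : Ph2 H f C h)
    (hw : f h = h) : Ph1 H f := by
  have iso : ∀ y, ¬ H.Red h y := by
    intro y hy
    obtain ⟨_, hyV, hne⟩ := adj_mem (H := H) (Or.inr hy)
    rcases P.adj _ _ (Or.inr hy) with h1 | h1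
    · exact hne (hw.symm.trans h1)
    · by_cases hyC : y ∈ C
      · exact hne (P.inj _ P.hub _ hyC (hw.trans h1.symm))
      · exact P.nop y hyV hyC h1
  have leaf : ∀ x, x ∉ C → Leaf H f x := fun x hx w hw he => hx (he ▸ P.map w hw)
  refine ⟨⟨h, P.sub P.hub⟩, fun x hx => P.sub (P.map x hx), P.adj, ?_, P.deg⟩
  intro x y hxy
  rcases P.red _ _ hxy with h1 | h1 | h1 | h1
  · exact Or.inl ⟨h1.1, leaf _ h1.2⟩
  · exact Or.inr ⟨h1.1, leaf _ h1.2⟩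
  · subst h1; exact absurd hxy (iso y)
  · subst h1; exact absurd (H.red_symm _ _ hxy) (iso x)

lemma card_contract {H : Trigraph V} {u v : V} (hv : v ∈ H.verts) :
    (H.contract u v).verts.card + 1 = H.verts.card := Finset.card_erase_add_one hv

lemma ph_main : ∀ n : ℕ, (∀ (H : Trigraph V) f, Ph1 H f → H.verts.card = n → W2 H) ∧
    (∀ (H : Trigraph V) f C h, Ph2 H f C h → H.verts.card = n → W2 H) := by
  intro n
  induction n with
  | zero =>
    refine ⟨fun H f P hc => ?_, fun H f C h P hc => ?_⟩
    · have := P.ne.card_pos; omega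
    · have := Finset.card_pos.2 ⟨h, P.sub P.hub⟩; omega
  | succ n ih =>
    have h1 : ∀ (H : Trigraph V) f, Ph1 H f → H.verts.card = n + 1 → W2 H := by
      intro H f P hc
      by_cases hn : n = 0
      · exact W2.base (by omega) P.deg
      by_cases hA : ∃ x ∈ H.verts, ∃ y ∈ H.verts, x ≠ y ∧ Leaf H f x ∧ Leaf H f y ∧ f x = f y
      · obtain ⟨x, hx, y, hy, hxy, lx, ly, hf⟩ := hA
        have : ∃ x ∈ H.verts, ∃ y ∈ H.verts, x ≠ y ∧ Leaf H f x ∧ Leaf H f y ∧ f x = f y ∧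
            (H.Red (f x) x ∨ H.redDeg (f x) ≤ 1) := by
          by_cases hr : H.redDeg (f x) ≤ 1
          · exact ⟨x, hx, y, hy, hxy, lx, ly, hf, Or.inr hr⟩
          · have h2 : 1 < {w | H.Red (f x) w}.ncard := by
              unfold Trigraph.redDeg at hr; omega
            rw [Set.one_lt_ncard (Set.toFinite _)] at h2
            obtain ⟨a, ha, b, hb, hab⟩ := h2
            have hh : ∀ a, H.Red (f x) a → a ∈ H.verts ∧ Leaf H f a ∧ f a = f x := by
              intro a ha
              rcases P.red _ _ ha with h | h
              · exact absurd rfl (h.2 x hx)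
              · exact ⟨(adj_mem (H := H) (Or.inr ha)).2.1, h.2, h.1⟩
            have h1 := hh a ha
            have h2 := hh b hb
            refine ⟨a, h1.1, b, h2.1, hab, h1.2.1, h2.2.1, h1.2.2.trans h2.2.2.symm, Or.inl ?_⟩
            rw [h1.2.2]; exact ha
        obtain ⟨x, hx, y, hy, hxy, lx, ly, hf, hr⟩ := this
        refine W2.step hx hy hxy P.deg (ih.1 _ f (P.stepA hx hy hxy lx ly hf hr) ?_)
        have := card_contract (u := x) hy; omega
      · have hall : ∀ a ∈ H.verts, ∀ b ∈ H.verts, Leaf H f a → Leaf H f b → f a = f b → a = b := by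
          intro a ha b hb la lb hab
          by_contra hne
          exact hA ⟨a, ha, b, hb, hne, la, lb, hab⟩
        by_cases hB : ∃ z ∈ H.verts, ¬ Leaf H f z ∧ ∀ w ∈ H.verts, f w = z → Leaf H f w
        · obtain ⟨z, hz, hzl, hzt⟩ := hB
          unfold Leaf at hzl
          push Not at hzl
          obtain ⟨y, hy, hyz⟩ := hzl
          have ly := hzt y hy hyz
          have hone : ∀ w ∈ H.verts, f w = z → w = y := fun w hw hwz =>
            hall w hw y hy (hzt w hw hwz) ly (hwz.trans hyz.symm)
          have hzy : z ≠ y := fun h => ly y hy (hyz.trans h)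
          refine W2.step hz hy hzy P.deg (ih.1 _ f (P.stepB hz hy hyz ly hone hall) ?_)
          have := card_contract (u := z) hy; omega
        · push Not at hB
          set N := H.verts.image f with hN
          have hNV : N ⊆ H.verts := by
            intro x hx
            obtain ⟨w, hw, rfl⟩ := Finset.mem_image.1 hx
            exact P.map w hw
          have leafN : ∀ x, Leaf H f x ↔ x ∉ N := by
            intro x
            simp [hN, Leaf]
          have hsurj : Set.SurjOn f N N := by
            intro z hz
            have hz : z ∈ N := hz
            obtain ⟨w, hw, hwz, hwl⟩ := hB z (hNV hz) (by rw [leafN]; simpa using hz)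
            rw [leafN, not_not] at hwl
            exact ⟨w, hwl, hwz⟩
          have hinj : Set.InjOn f N := Finset.injOn_of_surjOn_of_card_le f
            (fun x hx => Finset.mem_image_of_mem f (hNV hx)) hsurj le_rfl
          have hmap : ∀ x ∈ H.verts, f x ∈ N := fun x hx => Finset.mem_image_of_mem f hx
          by_cases hL : ∃ l ∈ H.verts, l ∉ N
          · obtain ⟨l, hl, hlN⟩ := hL
            have hne : f l ≠ l := fun h => hlN (h ▸ hmap l hl)
            have P2 : Ph2 (H.contract (f l) l) f N (f l) := by
              have hladj : ∀ b, H.Adj l b → b = f l := by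
                intro b hb
                rcases P.adj _ _ hb with h | h
                · exact h.symm
                · exact absurd (h ▸ hmap b (adj_mem hb).2.1) hlN
              refine ⟨?_, hmap l hl, ?_, ?_, ?_, ?_, ?_, ?_⟩
              · intro x hx
                exact Finset.mem_erase.2 ⟨fun h => hlN (h ▸ hx), hNV hx⟩
              · intro x hx
                exact hmap x (Finset.mem_of_mem_erase hx)
              · intro x hx y hy h
                exact hinj hx hy h
              · intro x hx y hy hxN hyN h
                exact hall x (Finset.mem_of_mem_erase hx) y (Finset.mem_of_mem_erase hy)
                  ((leafN x).2 hxN) ((leafN y).2 hyN) h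
              · intro x hx hxN h
                have hx := Finset.mem_erase.1 hx
                exact hx.1 (hall x hx.2 l hl ((leafN x).2 hxN) ((leafN l).2 hlN) h)
              · intro a b hab
                obtain ⟨ha, hb, hay, hby, hne, h | h | h⟩ := adj_contract hab
                · rw [h.1] at hne ⊢
                  rcases h.2 with h | h
                  · exact P.adj _ _ h
                  · exact absurd (hladj b h).symm hne
                · rw [h.1] at hne ⊢
                  rcases h.2 with h | h
                  · exact (P.adj _ _ h).symm
                  · exact absurd (hladj a h) hne
                · exact P.adj _ _ h.2.2
              · intro a b hab
                obtain ⟨ha, hb, hay, hby, hne, h | h | h⟩ := red_contract hab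
                · tauto
                · tauto
                · have := P.red _ _ h.2.2
                  rw [leafN, leafN] at this
                  tauto
            refine W2.step (P.map l hl) hl hne P.deg (ih.2 _ f N (f l) P2 ?_)
            have := card_contract (u := f l) hl; omega
          · push Not at hL
            have nored : ∀ x y, ¬ H.Red x y := by
              intro x y h
              have h1 := adj_mem (H := H) (Or.inr h)
              have := P.red _ _ h
              rw [leafN, leafN] at this
              have := hL x h1.1
              have := hL y h1.2.1
              tauto
            by_cases hid : ∃ h ∈ H.verts, f h ≠ h
            · obtain ⟨h, hh, hfh⟩ := hid
              have P2 : Ph2 H f N h := ⟨hNV, hL h hh, hmap, fun x hx y hy h => hinj hx hy h,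
                fun x hx _ _ hxN => absurd (hL x hx) hxN,
                fun x hx hxN => absurd (hL x hx) hxN, P.adj, fun x y h => absurd h (nored x y)⟩
              refine W2.step hh (P.map h hh) hfh.symm P.deg
                (ih.2 _ _ _ h (P2.step2 hfh (fun x hx hxN => absurd (hL x hx) hxN)) ?_)
              have := card_contract (u := h) (P.map h hh); omega
            · push Not at hid
              have noadj : ∀ x y, ¬ H.Adj x y := by
                intro x y h
                have h1 := adj_mem h
                have h2 := hid x h1.1
                have h3 := hid y h1.2.1
                rcases P.adj _ _ h with h | h
                · exact h1.2.2 (h2.symm.trans h)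
                · exact h1.2.2 (h.symm.trans h3)
              obtain ⟨x, hx, y, hy, hxy⟩ := Finset.one_lt_card.1 (show 1 < H.verts.card by omega)
              have nr : ∀ a b, ¬ (H.contract x y).Adj a b := by
                intro a b h
                have := adj_contract h
                have := noadj x a
                have := noadj x b
                have := noadj y a
                have := noadj y b
                have := noadj a b
                tauto
              have P2 : Ph1 (H.contract x y) f := by
                refine ⟨⟨x, Finset.mem_erase.2 ⟨hxy, hx⟩⟩, ?_, fun a b h => absurd h (nr a b),
                  fun a b h => absurd (Or.inr h) (nr a b), ?_⟩
                · intro w hw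
                  rw [hid w (Finset.mem_of_mem_erase hw)]
                  exact hw
                · intro v
                  exact redDeg_le_two v (fun _ => False) (by tauto)
                    (fun w h => absurd (Or.inr h) (nr v w))
              refine W2.step hx hy hxy P.deg (ih.1 _ f P2 ?_)
              have := card_contract (u := x) hy; omega
    refine ⟨h1, ?_⟩
    intro H f C h P hc
    by_cases hf : f h = h
    · exact h1 H f (P.toPh1 hf) hc
    · by_cases hl : ∃ l ∈ H.verts, l ∉ C ∧ f l = f h
      · obtain ⟨l, hl, hlC, hlf⟩ := hl
        have hne : h ≠ l := fun he => hlC (he ▸ P.hub)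
        refine W2.step (P.sub P.hub) hl hne P.deg (ih.2 _ f C h (P.step1 hlC ?_) ?_)
        · intro b hb _
          rcases P.adj _ _ hb with h1 | h1
          · exact hlf.symm.trans h1
          · exact absurd (h1 ▸ P.map b (adj_mem hb).2.1) hlC
        · have := card_contract (u := h) hl; omega
      · push Not at hl
        have hfV := P.sub (P.map h (P.sub P.hub))
        refine W2.step (P.sub P.hub) hfV (Ne.symm hf) P.deg (ih.2 _ _ _ h (P.step2 hf hl) ?_)
        have := card_contract (u := h) hfV; omega

lemma W2_of_pseudoforest [Nonempty V] (G : SimpleGraph V) (f : V → V)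
    (hf : ∀ x y, G.Adj x y → f x = y ∨ f y = x) : W2 G.toTrigraph := by
  refine (ph_main _).1 G.toTrigraph f ⟨Finset.univ_nonempty, fun x _ => Finset.mem_univ _, ?_,
    fun x y h => h.elim, ?_⟩ rfl
  · intro x y h
    rcases h with h | h
    · exact hf x y h
    · exact h.elim
  · intro v
    exact redDeg_le_two v (fun _ => False) (by tauto) (fun w h => h.elim)

end upper
end TwwAux

namespace TwwAux
open Trigraph

section lower

/-- The spider: centre 0, middle vertices 1,2,3, leaves 4,5,6. -/
def spE (i j : Fin 7) : Bool :=
  (i == 0 && (j == 1 || j == 2 || j == 3)) || (j == 0 && (i == 1 || i == 2 || i == 3)) ||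
  (i == 1 && j == 4) || (i == 2 && j == 5) || (i == 3 && j == 6) ||
  (j == 1 && i == 4) || (j == 2 && i == 5) || (j == 3 && i == 6)

/-- the four admissible kernels -/
def ker : Fin 4 → Fin 7 → Fin 7
  | 0, i => i
  | 1, i => if i = 4 then 1 else i
  | 2, i => if i = 5 then 2 else i
  | 3, i => if i = 6 then 3 else i

def mrg (a : Fin 4) (x y : Fin 7) (i : Fin 7) : Fin 7 :=
  if ker a i = ker a y then ker a x else ker a i

/-- nonhomogeneous pair of classes -/
def nonhom (k : Fin 7 → Fin 7) (i j : Fin 7) : Prop :=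
  k i ≠ k j ∧ (∃ i' j', k i' = k i ∧ k j' = k j ∧ spE i' j' = true) ∧
    (∃ i' j', k i' = k i ∧ k j' = k j ∧ spE i' j' = false)

instance (k : Fin 7 → Fin 7) (i j : Fin 7) : Decidable (nonhom k i j) := by
  unfold nonhom; infer_instance

def sameK (k k' : Fin 7 → Fin 7) : Prop := ∀ i j, k i = k j ↔ k' i = k' j

instance (k k' : Fin 7 → Fin 7) : Decidable (sameK k k') := by
  unfold sameK; infer_instance

set_option maxRecDepth 100000 in
set_option maxHeartbeats 4000000 in
lemma spider_check : ∀ (a : Fin 4) (x y : Fin 7), ker a x ≠ ker a y →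
    (∃ b, sameK (mrg a x y) (ker b)) ∨
    ∃ i j k, mrg a x y j ≠ mrg a x y k ∧ nonhom (mrg a x y) i j ∧ nonhom (mrg a x y) i k := by
  decide +kernel

variable {V : Type*} [Fintype V] [DecidableEq V]

structure Emb (H : Trigraph V) (φ : Fin 7 → V) : Prop where
  mem : ∀ i, φ i ∈ H.verts
  blk : ∀ i j, φ i ≠ φ j → H.Black (φ i) (φ j) → spE i j = true
  non : ∀ i j, φ i ≠ φ j → spE i j = true → H.Adj (φ i) (φ j)

lemma Emb.contract {H : Trigraph V} {φ : Fin 7 → V} (E : Emb H φ) {u v : V} (hu : u ∈ H.verts)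
    (huv : u ≠ v) : Emb (H.contract u v) (fun i => if φ i = v then u else φ i) := by
  have hm : ∀ i, (if φ i = v then u else φ i) ∈ H.verts.erase v := by
    intro i
    split_ifs with h
    · exact Finset.mem_erase.2 ⟨huv, hu⟩
    · exact Finset.mem_erase.2 ⟨h, E.mem i⟩
  refine ⟨hm, ?_, ?_⟩
  · rintro i j hne ⟨_, _, _, h⟩
    have key := E.blk i j
    have hs := H.black_symm
    by_cases hi : φ i = v <;> by_cases hj : φ j = v <;> by_cases hi' : φ i = u <;>
      by_cases hj' : φ j = u <;> simp only [hi, hj, hi', hj', if_true, if_false] at * <;> grind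
  · intro i j hne h
    have key := E.non i j
    have hs := H.black_symm
    have hr := H.red_symm
    have h1 := hm i
    have h2 := hm j
    by_cases hb : (H.contract u v).Black (if φ i = v then u else φ i) (if φ j = v then u else φ j)
    · exact Or.inl hb
    · right
      have hb' : ¬ _ := fun hh => hb ⟨h1, h2, hne, hh⟩
      refine ⟨h1, h2, hne, ?_⟩
      have hsy : ∀ a b, H.Adj a b → H.Adj b a := fun a b => adj_symm
      have hA : ∀ a b, H.Adj a b ↔ H.Black a b ∨ H.Red a b := fun a b => Iff.rfl
      clear hb h1 h2 hm
      grind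

lemma Emb.red {H : Trigraph V} {φ : Fin 7 → V} (E : Emb H φ) {k : Fin 7 → Fin 7}
    (hk : ∀ i j, φ i = φ j ↔ k i = k j) {i j : Fin 7} (hn : nonhom k i j) :
    H.Red (φ i) (φ j) := by
  obtain ⟨h1, ⟨a, b, ha, hb, hab⟩, ⟨c, d, hc, hd, hcd⟩⟩ := hn
  have hne : φ i ≠ φ j := fun h => h1 ((hk _ _).1 h)
  rw [← hk] at ha hb hc hd
  have hA : H.Adj (φ i) (φ j) := by
    rw [← ha, ← hb] at hne ⊢
    exact E.non a b hne hab
  rcases hA with hA | hA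
  · rw [← hc, ← hd] at hne hA
    have := E.blk c d hne hA
    simp [this] at hcd
  · exact hA

lemma no_seq : ∀ (L : List (V × V)) (H : Trigraph V) (φ : Fin 7 → V), Emb H φ →
    (∃ a, ∀ i j, φ i = φ j ↔ ker a i = ker a j) → H.ValidSeq L →
    (∀ L', L' <+: L → ∀ v, (H.applySeq L').redDeg v ≤ 1) →
    (H.applySeq L).verts.card ≠ 1 := by
  intro L
  induction L with
  | nil =>
    intro H φ E ⟨a, ha⟩ _ _ h1
    have h1 : H.verts.card = 1 := h1
    have : φ 0 = φ 1 := Finset.card_le_one.1 h1.le _ (E.mem 0) _ (E.mem 1)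
    rw [ha] at this
    clear ha
    revert a
    decide
  | cons p L ih =>
    rintro H φ E ⟨a, ha⟩ ⟨hu, hv, huv, hL⟩ hd
    obtain ⟨u, v⟩ := p
    simp only at hu hv huv hL
    have E' := E.contract hu huv (v := v)
    refine ih (H.contract u v) _ E' ?_ hL ?_
    · by_cases hv' : ∃ y, φ y = v
      · by_cases hu' : ∃ x, φ x = u
        · obtain ⟨y, hy⟩ := hv'
          obtain ⟨x, hx⟩ := hu'
          have hne : ker a x ≠ ker a y := by rw [Ne, ← ha, hx, hy]; exact huv
          have hk : ∀ i j, ((if φ i = v then u else φ i) = (if φ j = v then u else φ j)) ↔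
              mrg a x y i = mrg a x y j := by
            intro i j
            unfold mrg
            rw [← hx, ← hy]
            simp only [ha]
            have e1 := ha x i
            have e2 := ha x j
            have e3 := ha i x
            have e4 := ha i j
            split_ifs <;> simp_all
          rcases spider_check a x y hne with ⟨b, hb⟩ | ⟨i, j, k, hjk, hij, hik⟩
          · exact ⟨b, fun i j => (hk i j).trans (hb i j)⟩
          · exfalso
            have r1 := E'.red hk hij
            have r2 := E'.red hk hik
            have hd1 := hd [(u, v)] (by simp) (if φ i = v then u else φ i)
            have : 1 < {w | (H.contract u v).Red (if φ i = v then u else φ i) w}.ncard := by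
              rw [Set.one_lt_ncard (Set.toFinite _)]
              exact ⟨_, r1, _, r2, fun h => hjk ((hk _ _).1 h)⟩
            have hd1 : {w | (H.contract u v).Red (if φ i = v then u else φ i) w}.ncard ≤ 1 := hd1
            omega
        · refine ⟨a, fun i j => ?_⟩
          push Not at hu'
          rw [← ha]
          have h1 := hu' i
          have h2 := hu' j
          grind
      · refine ⟨a, fun i j => ?_⟩
        push Not at hv'
        rw [← ha, if_neg (hv' i), if_neg (hv' j)]
    · intro L' hL' w
      exact hd ((u, v) :: L') (by rw [List.cons_prefix_cons]; exact ⟨rfl, hL'⟩) w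

def HasSpider (G : SimpleGraph V) : Prop := ∃ φ : Fin 7 → V, Function.Injective φ ∧
  ∀ i j, i ≠ j → (G.Adj (φ i) (φ j) ↔ spE i j = true)

theorem tww_eq_two {G : SimpleGraph V} (hW : W2 G.toTrigraph) (hS : HasSpider G) : G.tww = 2 := by
  unfold SimpleGraph.tww Trigraph.tww
  apply le_antisymm
  · exact Nat.sInf_le hW
  · apply le_csInf ⟨2, hW⟩
    rintro d ⟨L, h1, h2, h3⟩
    by_contra hlt
    obtain ⟨φ, hφ, hadj⟩ := hS
    refine no_seq L G.toTrigraph φ ⟨fun i => Finset.mem_univ _, ?_, ?_⟩ ⟨0, ?_⟩ h1 ?_ h2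
    · intro i j hij h
      exact (hadj i j (fun h => hij (h ▸ rfl))).1 h
    · intro i j hij h
      exact Or.inl ((hadj i j (fun h => hij (h ▸ rfl))).2 h)
    · intro i j
      exact hφ.eq_iff
    · intro L' hL' v
      have := h3 L' hL' v
      omega

end lower
end TwwAux

namespace TwwAux

section struct
variable {V : Type*} [Fintype V] [DecidableEq V]

def Bad (G : SimpleGraph V) : Prop := ∃ (k : ℕ) (v : Fin (k + 1) → V), Function.Injective v ∧
  (∀ t : Fin k, G.Adj (v t.castSucc) (v t.succ)) ∧
  ∃ i j : Fin (k + 1), 2 ≤ i.val ∧ j.val + 2 ≤ k ∧ G.Adj (v 0) (v i) ∧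
    G.Adj (v (Fin.last k)) (v j) ∧ ¬(i = Fin.last k ∧ j = 0)

lemma grow (R : V → V → Prop) (hs : ∀ x y, R x y → R y x) : ∀ (n : ℕ) (l : List V) (hl : 0 < l.length),
    l.Nodup → l.IsChain R → Fintype.card V - l.length ≤ n →
    ∃ m : List V, (m ++ l).Nodup ∧ (m ++ l).IsChain R ∧
      ∀ y, R ((m ++ l)[0]'(by simp; omega)) y → y ∈ m ++ l := by
  intro n
  induction n with
  | zero =>
    intro l hl hn hc hcard
    refine ⟨[], hn, hc, ?_⟩
    intro y hy
    by_contra hy'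
    have : (y :: l).Nodup := List.nodup_cons.2 ⟨by simpa using hy', hn⟩
    have := this.length_le_card
    simp at this
    omega
  | succ n ih =>
    intro l hl hn hc hcard
    by_cases h : ∀ y, R (l[0]) y → y ∈ l
    · exact ⟨[], hn, hc, h⟩
    · push Not at h
      obtain ⟨y, hy, hyl⟩ := h
      obtain ⟨m, h1, h2, h3⟩ := ih (y :: l) (by simp) (List.nodup_cons.2 ⟨hyl, hn⟩) (by
        rw [List.isChain_cons]
        refine ⟨?_, hc⟩
        intro z hz
        rcases l with _ | ⟨a, l⟩
        · simp at hz
        · simp at hz hy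
          subst hz
          exact hs _ _ hy) (by simp; omega)
      refine ⟨m ++ [y], by simpa using h1, by simpa using h2, ?_⟩
      intro w hw
      have := h3 w (by simpa using hw)
      simpa using this

lemma bad_of_core (G : SimpleGraph V) (R : V → V → Prop) (hs : ∀ x y, R x y → R y x)
    (hG : ∀ x y, R x y → G.Adj x y)
    (h2 : ∀ x y, R x y → ∀ a, ∃ y, R x y ∧ y ≠ a)
    (x0 : V) (h3 : ∀ a b, ∃ y, R x0 y ∧ y ≠ a ∧ y ≠ b) : Bad G := by
  have irr : ∀ x, ¬ R x x := fun x h => (hG x x h).ne rfl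
  obtain ⟨m, hN, hC, hH⟩ := grow R hs _ [x0] (by simp) (by simp) (by simp) le_rfl
  obtain ⟨l1, hl1⟩ : ∃ l1, l1 = m ++ [x0] := ⟨_, rfl⟩
  simp only [← hl1] at hN hC hH
  have hlen1 : l1.length = m.length + 1 := by simp [hl1]
  have hlast1 : l1[l1.length - 1]'(by omega) = x0 := by simp [hl1]
  have hL : 2 ≤ l1.length := by
    by_contra hlt
    obtain ⟨y, hy, -⟩ := h3 x0 x0
    have hm : m = [] := by
      rw [← List.length_eq_zero_iff]; omega
    subst hm
    have := hH y (by simpa [hl1] using hy)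
    simp [hl1] at this
    exact irr _ (this ▸ hy)
  -- neighbour of the head of l1
  have hC' := List.isChain_iff_getElem.1 hC
  obtain ⟨y, hy, hy1⟩ := h2 _ _ (hC' 0 (by omega)) l1[1]
  obtain ⟨i1, hi1, hi1y⟩ := List.getElem_of_mem (hH y hy)
  have hi10 : i1 ≠ 0 := by
    rintro rfl
    exact irr _ (hi1y ▸ hy)
  have hi11 : i1 ≠ 1 := by
    rintro rfl
    exact hy1 hi1y.symm
  obtain ⟨m', hN3, hC3, hH3⟩ := grow R hs _ l1.reverse (by simp; omega) (List.nodup_reverse.2 hN)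
    (List.isChain_reverse.2 (hC.imp (fun a b h => hs _ _ h))) le_rfl
  obtain ⟨l3, hl3⟩ : ∃ l3, l3 = m' ++ l1.reverse := ⟨_, rfl⟩
  simp only [← hl3] at hN3 hC3 hH3
  have hlen3 : l3.length = m'.length + l1.length := by simp [hl3]
  have hget : ∀ (t : ℕ) (ht : t < l1.length) (h : m'.length + (l1.length - 1 - t) < l3.length),
      l3[m'.length + (l1.length - 1 - t)]'h = l1[t] := by
    intro t ht h
    simp only [hl3]
    rw [List.getElem_append_right (by omega), List.getElem_reverse]
    congr 1
    omega
  have hC3' := List.isChain_iff_getElem.1 hC3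
  obtain ⟨k, hk⟩ : ∃ k, l3.length = k + 1 := ⟨l3.length - 1, by omega⟩
  have hlast : l3[k]'(by omega) = l1[0] := by
    rw [← hget 0 (by omega) (by omega)]
    congr 1; omega
  -- good neighbour of the head
  have hend : ∃ i, ∃ hi : i < l3.length, 2 ≤ i ∧ R (l3[0]) (l3[i]) ∧ (i = k → m' ≠ []) := by
    have fin : ∀ y', R (l3[0]) y' → y' ≠ l3[1]'(by omega) → ∃ i, ∃ hi : i < l3.length, 2 ≤ i ∧ l3[i] = y' := by
      intro y' h1 h2
      obtain ⟨i, hi, hiy⟩ := List.getElem_of_mem (hH3 y' h1)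
      refine ⟨i, hi, ?_, hiy⟩
      have a0 : i ≠ 0 := by
        rintro rfl
        exact irr _ (hiy ▸ h1)
      have a1 : i ≠ 1 := by
        rintro rfl
        exact h2 hiy.symm
      omega
    by_cases hm' : m' = []
    · have hx0 : l3[0] = x0 := by
        have e1 := hget (l1.length - 1) (by omega) (by omega)
        rw [hlast1] at e1
        rw [← e1]
        congr 1
        simp [hm']
      obtain ⟨y', ha, hb, hc⟩ := h3 (l3[1]'(by omega)) (l3[k]'(by omega))
      obtain ⟨i, hi, hi2, hiy⟩ := fin y' (by rw [hx0]; exact ha) hb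
      refine ⟨i, hi, hi2, by rw [hiy, hx0]; exact ha, ?_⟩
      rintro rfl
      exact absurd hiy.symm hc
    · obtain ⟨y', ha, hb⟩ := h2 _ _ (hC3' 0 (by omega)) (l3[1]'(by omega))
      obtain ⟨i, hi, hi2, hiy⟩ := fin y' ha hb
      exact ⟨i, hi, hi2, by rw [hiy]; exact ha, fun _ => hm'⟩
  obtain ⟨i, hi, hi2, hiR, hik⟩ := hend
  refine ⟨k, fun t => l3[t.val]'(by omega), ?_, ?_, ⟨i, by omega⟩,
    ⟨m'.length + (l1.length - 1 - i1), by omega⟩, hi2, ?_, ?_, ?_, ?_⟩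
  · intro a b hab
    exact Fin.ext (hN3.getElem_inj_iff.1 hab)
  · intro t
    exact hG _ _ (hC3' t.val (by omega))
  · have hi1' : i1 < l1.length := hi1
    have : m'.length + (l1.length - 1 - i1) + 2 ≤ k := by omega
    exact this
  · exact hG _ _ hiR
  · apply hG
    simp only [Fin.val_last]
    rw [hlast, hget i1 hi1 (by omega), hi1y]
    exact hy
  · rintro ⟨h1, h2⟩
    rw [Fin.ext_iff] at h1 h2
    simp at h1 h2
    exact hik h1 h2.1

lemma hall_cond (G : SimpleGraph V) (hB : ¬ Bad G) : ∀ (n : ℕ) (W : Finset V) (E : Finset (Sym2 V)),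
    W.card = n → (∀ e ∈ E, e ∈ G.edgeSet) → (∀ e ∈ E, ∀ x ∈ e, x ∈ W) → E.card ≤ W.card := by
  intro n
  induction n with
  | zero =>
    intro W E hW hE hEW
    rw [Finset.card_eq_zero] at hW
    subst hW
    rw [Finset.card_empty, Nat.le_zero, Finset.card_eq_zero, Finset.eq_empty_iff_forall_notMem]
    intro e he
    induction e with
    | _ x y => simpa using hEW _ he x (by simp)
  | succ n ih =>
    intro W E hW hE hEW
    by_contra hlt
    push Not at hlt
    have hdeg2 : ∀ x ∈ W, 2 ≤ (E.filter (fun e => x ∈ e)).card := by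
      intro x hx
      have h1 := ih (W.erase x) (E.filter (fun e => ¬ x ∈ e)) (by
        rw [Finset.card_erase_of_mem hx]; omega) (fun e he => hE e (Finset.mem_filter.1 he).1)
        (by
          intro e he y hy
          rw [Finset.mem_filter] at he
          refine Finset.mem_erase.2 ⟨?_, hEW e he.1 y hy⟩
          rintro rfl
          exact he.2 hy)
      rw [Finset.card_erase_of_mem hx] at h1
      have h2 := Finset.card_filter_add_card_filter_not (s := E) (fun e => x ∈ e)
      omega
    have hsum : ∑ x ∈ W, (E.filter (fun e => x ∈ e)).card = 2 * E.card := by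
      have := Finset.sum_card_bipartiteAbove_eq_sum_card_bipartiteBelow (s := W) (t := E)
        (fun x e => x ∈ e)
      unfold Finset.bipartiteAbove Finset.bipartiteBelow at this
      rw [this, Finset.sum_const_nat (m := 2), mul_comm]
      intro e he
      rw [← Sym2.card_toFinset_of_not_isDiag e (G.not_isDiag_of_mem_edgeSet (hE e he))]
      congr 1
      ext x
      simp only [Finset.mem_filter, Sym2.mem_toFinset]
      exact ⟨fun h => h.2, fun h => ⟨hEW e he x h, h⟩⟩
    obtain ⟨x0, hx0, hd3⟩ : ∃ x ∈ W, 2 < (E.filter (fun e => x ∈ e)).card := by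
      by_contra hcon
      push Not at hcon
      have := Finset.sum_le_card_nsmul W _ 2 hcon
      rw [hsum] at this
      simp at this
      omega
    apply hB
    have other : ∀ x e, e ∈ E → x ∈ e → ∃ y, e = s(x, y) := by
      intro x e _ hx
      obtain ⟨y, rfl⟩ := hx
      exact ⟨y, rfl⟩
    refine bad_of_core G (fun x y => s(x, y) ∈ E) ?_ ?_ ?_ x0 ?_
    · intro x y h; rw [Sym2.eq_swap]; exact h
    · intro x y h; exact hE _ h
    · intro x y h a
      have hx : x ∈ W := hEW _ h x (by simp)
      obtain ⟨e, he, e', he', hne⟩ := Finset.one_lt_card.1 (hdeg2 x hx)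
      rw [Finset.mem_filter] at he he'
      obtain ⟨u, rfl⟩ := other x e he.1 he.2
      obtain ⟨u', rfl⟩ := other x e' he'.1 he'.2
      by_cases hu : u = a
      · refine ⟨u', he'.1, ?_⟩
        rintro rfl
        exact hne (by rw [hu])
      · exact ⟨u, he.1, hu⟩
    · intro a b
      obtain ⟨e, he, e', he', e'', he'', hne, hne', hne''⟩ := Finset.two_lt_card.1 hd3
      rw [Finset.mem_filter] at he he' he''
      obtain ⟨u, rfl⟩ := other x0 e he.1 he.2
      obtain ⟨u', rfl⟩ := other x0 e' he'.1 he'.2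
      obtain ⟨u'', rfl⟩ := other x0 e'' he''.1 he''.2
      have n1 : u ≠ u' := fun h => hne (by rw [h])
      have n2 : u ≠ u'' := fun h => hne' (by rw [h])
      have n3 : u' ≠ u'' := fun h => hne'' (by rw [h])
      by_cases c1 : u ≠ a ∧ u ≠ b
      · exact ⟨u, he.1, c1⟩
      by_cases c2 : u' ≠ a ∧ u' ≠ b
      · exact ⟨u', he'.1, c2⟩
      · refine ⟨u'', he''.1, ?_⟩
        grind

lemma pseudoforest_of_not_bad (G : SimpleGraph V) (hB : ¬ Bad G) :
    ∃ f : V → V, ∀ x y, G.Adj x y → f x = y ∨ f y = x := by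
  classical
  have hall := (Finset.all_card_le_biUnion_card_iff_exists_injective
    (fun e : G.edgeSet => (e : Sym2 V).toFinset)).1 (by
      intro s
      have := hall_cond G hB _ (s.biUnion fun e : G.edgeSet => (e : Sym2 V).toFinset)
        (s.image Subtype.val) rfl (by
          intro e he
          obtain ⟨e', _, rfl⟩ := Finset.mem_image.1 he
          exact e'.2) (by
          intro e he x hx
          obtain ⟨e', he', rfl⟩ := Finset.mem_image.1 he
          exact Finset.mem_biUnion.2 ⟨e', he', Sym2.mem_toFinset.2 hx⟩)
      rwa [Finset.card_image_of_injective _ Subtype.val_injective] at this)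
  obtain ⟨g, hg, hgm⟩ := hall
  have : ∀ x, ∃ y, ∀ e : G.edgeSet, g e = x → (e : Sym2 V) = s(x, y) := by
    intro x
    by_cases h : ∃ e, g e = x
    · obtain ⟨e, he⟩ := h
      have h1 := hgm e
      rw [he, Sym2.mem_toFinset] at h1
      obtain ⟨y, hy⟩ := h1
      refine ⟨y, fun e' he' => ?_⟩
      rw [hg (he'.trans he.symm)]
      exact hy
    · exact ⟨x, fun e he => absurd ⟨e, he⟩ h⟩
  choose f hf using this
  refine ⟨f, fun x y hxy => ?_⟩
  have h1 := hgm ⟨s(x, y), hxy⟩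
  have h2 := hf _ ⟨s(x, y), hxy⟩ rfl
  rw [Sym2.mem_toFinset] at h1
  simp only at h1 h2
  rcases Sym2.mem_iff.1 h1 with h | h
  · left
    rw [h] at h2
    exact (Sym2.congr_right.1 h2).symm
  · right
    rw [h, Sym2.eq_swap] at h2
    exact (Sym2.congr_right.1 h2).symm

end struct
end TwwAux

namespace TwwAux
open Finset

section prob
variable {α : Type*} [DecidableEq α]

/-- expectation over random subset of `U` -/
noncomputable def Ex (U : Finset α) (p : ℝ) (g : Finset α → ℝ) : ℝ :=
  ∑ s ∈ U.powerset, p ^ s.card * (1 - p) ^ (U.card - s.card) * g s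

lemma Ex_mono {U : Finset α} {p : ℝ} (h0 : 0 ≤ p) (h1 : p ≤ 1) {g g' : Finset α → ℝ}
    (h : ∀ s ∈ U.powerset, g s ≤ g' s) : Ex U p g ≤ Ex U p g' := by
  refine Finset.sum_le_sum fun s hs => mul_le_mul_of_nonneg_left (h s hs) ?_
  have : 0 ≤ 1 - p := by linarith
  positivity

lemma Ex_add {U : Finset α} {p : ℝ} (g g' : Finset α → ℝ) :
    Ex U p (fun s => g s + g' s) = Ex U p g + Ex U p g' := by
  unfold Ex
  rw [← Finset.sum_add_distrib]
  exact Finset.sum_congr rfl fun s _ => by ring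

lemma Ex_mul {U : Finset α} {p : ℝ} (c : ℝ) (g : Finset α → ℝ) :
    Ex U p (fun s => c * g s) = c * Ex U p g := by
  unfold Ex
  rw [Finset.mul_sum]
  exact Finset.sum_congr rfl fun s _ => by ring

lemma Ex_sum {U : Finset α} {p : ℝ} {ι : Type*} (I : Finset ι) (g : ι → Finset α → ℝ) :
    Ex U p (fun s => ∑ i ∈ I, g i s) = ∑ i ∈ I, Ex U p (g i) := by
  unfold Ex
  rw [Finset.sum_comm]
  exact Finset.sum_congr rfl fun s _ => by rw [Finset.mul_sum]

lemma Ex_const {U : Finset α} {p : ℝ} (c : ℝ) : Ex U p (fun _ => c) = c := by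
  unfold Ex
  rw [← Finset.sum_mul, Finset.sum_pow_mul_eq_add_pow]
  simp

lemma Ex_cyl {U : Finset α} (p : ℝ) {T F : Finset α} (hT : T ⊆ U) (hF : F ⊆ U)
    (hTF : Disjoint T F) :
    Ex U p (fun s => if T ⊆ s ∧ Disjoint F s then 1 else 0) = p ^ T.card * (1 - p) ^ F.card := by
  have h := Finset.prod_add (fun i => if i ∈ F then 0 else p) (fun i => if i ∈ T then 0 else 1 - p) U
  have hL : ∏ i ∈ U, ((if i ∈ F then 0 else p) + (if i ∈ T then 0 else 1 - p)) =
      p ^ T.card * (1 - p) ^ F.card := by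
    have : ∀ i ∈ U, ((if i ∈ F then 0 else p) + (if i ∈ T then 0 else 1 - p)) =
        (if i ∈ T then p else 1) * (if i ∈ F then 1 - p else 1) := by
      intro i _
      by_cases h1 : i ∈ T
      · have h2 : i ∉ F := Finset.disjoint_left.1 hTF h1
        simp [h1, h2]
      · by_cases h2 : i ∈ F <;> simp [h1, h2]
    rw [Finset.prod_congr rfl this, Finset.prod_mul_distrib, Finset.prod_ite_mem,
      Finset.prod_ite_mem, Finset.inter_eq_right.2 hT, Finset.inter_eq_right.2 hF]
    simp
  rw [← hL, h]
  unfold Ex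
  refine Finset.sum_congr rfl fun s hs => ?_
  rw [Finset.mem_powerset] at hs
  beta_reduce
  by_cases h1 : Disjoint F s
  · have e1 : ∏ i ∈ s, (if i ∈ F then 0 else p) = p ^ s.card := by
      rw [Finset.prod_congr rfl (fun i hi => if_neg (Finset.disjoint_right.1 h1 hi))]
      simp
    by_cases h2 : T ⊆ s
    · have e2 : ∏ i ∈ U \ s, (if i ∈ T then 0 else 1 - p) = (1 - p) ^ (U.card - s.card) := by
        rw [Finset.prod_congr rfl (fun i hi => if_neg (fun h => (Finset.mem_sdiff.1 hi).2 (h2 h)))]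
        simp [Finset.card_sdiff_of_subset hs]
      rw [e1, e2, if_pos ⟨h2, h1⟩, mul_one]
    · obtain ⟨x, hx, hxs⟩ := Finset.not_subset.1 h2
      have e2 : ∏ i ∈ U \ s, (if i ∈ T then 0 else 1 - p) = 0 :=
        Finset.prod_eq_zero (Finset.mem_sdiff.2 ⟨hT hx, hxs⟩) (if_pos hx)
      rw [e2, if_neg (fun h => h2 h.1)]
      simp
  · obtain ⟨x, hx, hxs⟩ := Finset.not_disjoint_iff.1 h1
    have e1 : ∏ i ∈ s, (if i ∈ F then 0 else p) = 0 := Finset.prod_eq_zero hxs (if_pos hx)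
    rw [e1, if_neg (fun h => h1 h.2)]
    simp

lemma Ex_sup {U : Finset α} (p : ℝ) {T : Finset α} (hT : T ⊆ U) :
    Ex U p (fun s => if T ⊆ s then 1 else 0) = p ^ T.card := by
  have := Ex_cyl p hT (Finset.empty_subset U) (Finset.disjoint_empty_right T)
  simpa using this

/-- edges of the complete graph -/
noncomputable def UU (n : ℕ) : Finset (Sym2 (Fin n)) := (⊤ : SimpleGraph (Fin n)).edgeFinset

lemma mem_UU {n : ℕ} {e : Sym2 (Fin n)} : e ∈ UU n ↔ ¬ e.IsDiag := by
  simp [UU]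

open Classical in
lemma erProb_eq (n : ℕ) (p : ℝ) (A : Set (SimpleGraph (Fin n))) :
    erProb n p A = Ex (UU n) p
      (fun s => if SimpleGraph.fromEdgeSet (s : Set (Sym2 (Fin n))) ∈ A then 1 else 0) := by
  unfold erProb Ex
  rw [finsum_eq_sum_of_fintype]
  have hU : (UU n).card = n.choose 2 := by
    unfold UU
    convert SimpleGraph.card_edgeFinset_top_eq_card_choose_two (V := Fin n)
    simp
  have hse : ∀ s ∈ (UU n).powerset, (SimpleGraph.fromEdgeSet (s : Set (Sym2 (Fin n)))).edgeSet = s := by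
    intro s hs
    rw [SimpleGraph.edgeSet_fromEdgeSet, sdiff_eq_left, Set.disjoint_left]
    intro e he hd
    exact mem_UU.1 (Finset.mem_powerset.1 hs he) hd
  refine Finset.sum_bij' (fun G _ => G.edgeFinset) (fun s _ => SimpleGraph.fromEdgeSet s) ?_ ?_ ?_ ?_ ?_
  · intro G _
    rw [Finset.mem_powerset]
    intro e he
    rw [mem_UU]
    exact G.not_isDiag_of_mem_edgeSet (SimpleGraph.mem_edgeFinset.1 he)
  · intro s _
    exact Finset.mem_univ _
  · intro G _
    simp
  · intro s hs
    rw [← Finset.coe_inj, SimpleGraph.coe_edgeFinset, hse s hs]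
  · intro G _
    rw [finsum_eq_if, hU]
    have h1 : G.edgeSet.ncard = G.edgeFinset.card := by
      rw [← SimpleGraph.coe_edgeFinset, Set.ncard_coe_finset]
    rw [h1]
    simp

end prob

section first

def badT {n k : ℕ} (v : Fin (k + 1) → Fin n) (i j : Fin (k + 1)) : Finset (Sym2 (Fin n)) :=
  (insert s(0, i) (insert s(Fin.last k, j)
    (Finset.univ.image (fun t : Fin k => s(t.castSucc, t.succ))))).image (Sym2.map v)

lemma badT_card {n k : ℕ} {v : Fin (k + 1) → Fin n} (hv : Function.Injective v) {i j : Fin (k + 1)}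
    (hi : 2 ≤ i.val) (hj : j.val + 2 ≤ k) (hij : ¬(i = Fin.last k ∧ j = 0)) :
    (badT v i j).card = k + 2 := by
  unfold badT
  rw [Finset.card_image_of_injective _ (Sym2.map.injective hv), Finset.card_insert_of_notMem,
    Finset.card_insert_of_notMem, Finset.card_image_of_injective]
  · simp
  · intro a b hab
    simp only [Sym2.eq_iff, Fin.ext_iff, Fin.val_castSucc, Fin.val_succ] at hab
    ext
    omega
  · simp only [Finset.mem_image, Finset.mem_univ, true_and, not_exists, Sym2.eq_iff, Fin.ext_iff,
      Fin.val_castSucc, Fin.val_succ, Fin.val_last]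
    intro a
    omega
  · simp only [Finset.mem_insert, Finset.mem_image, Finset.mem_univ, true_and, not_exists, Sym2.eq_iff, Fin.ext_iff,
      Fin.val_castSucc, Fin.val_succ, Fin.val_last, Fin.val_zero, not_or] at hij ⊢
    refine ⟨by omega, ?_⟩
    intro a
    omega

lemma badT_sub {n k : ℕ} {v : Fin (k + 1) → Fin n} (hv : Function.Injective v) {i j : Fin (k + 1)}
    (hi : 2 ≤ i.val) (hj : j.val + 2 ≤ k) : badT v i j ⊆ UU n := by
  intro e he
  unfold badT at he
  obtain ⟨e', he', rfl⟩ := Finset.mem_image.1 he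
  rw [mem_UU, Sym2.isDiag_map hv]
  simp only [Finset.mem_insert, Finset.mem_image, Finset.mem_univ, true_and] at he'
  rcases he' with rfl | rfl | ⟨a, rfl⟩
  · simp only [Sym2.mk_isDiag_iff, Fin.ext_iff, Fin.val_zero]; omega
  · simp only [Sym2.mk_isDiag_iff, Fin.ext_iff, Fin.val_last]; omega
  · simp only [Sym2.mk_isDiag_iff, Fin.ext_iff, Fin.val_castSucc, Fin.val_succ]; omega

def badV {n k : ℕ} (x : (Fin (k + 1) → Fin n) × Fin (k + 1) × Fin (k + 1)) : Prop :=
  Function.Injective x.1 ∧ 2 ≤ x.2.1.val ∧ x.2.2.val + 2 ≤ k ∧ ¬(x.2.1 = Fin.last k ∧ x.2.2 = 0)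

open Classical in
lemma bad_bound (n : ℕ) (p : ℝ) (h0 : 0 ≤ p) (h1 : p ≤ 1) :
    Ex (UU n) p (fun s => if Bad (SimpleGraph.fromEdgeSet (s : Set (Sym2 (Fin n)))) then 1 else 0)
      ≤ ∑ k ∈ Finset.range n, ((k : ℝ) + 1) ^ 2 * (n : ℝ) ^ (k + 1) * p ^ (k + 2) := by
  have step : Ex (UU n) p (fun s => if Bad (SimpleGraph.fromEdgeSet (s : Set (Sym2 (Fin n)))) then 1 else 0)
      ≤ Ex (UU n) p (fun s => ∑ k ∈ Finset.range n,
        ∑ x ∈ (Finset.univ : Finset ((Fin (k + 1) → Fin n) × Fin (k + 1) × Fin (k + 1))).filter badV,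
          if badT x.1 x.2.1 x.2.2 ⊆ s then 1 else 0) := by
    refine Ex_mono h0 h1 fun s hs => ?_
    have nn : ∀ k ∈ Finset.range n, (0 : ℝ) ≤
        ∑ x ∈ (Finset.univ : Finset ((Fin (k + 1) → Fin n) × Fin (k + 1) × Fin (k + 1))).filter badV,
          if badT x.1 x.2.1 x.2.2 ⊆ s then 1 else 0 := fun k _ =>
      Finset.sum_nonneg fun x _ => by split_ifs <;> norm_num
    split_ifs with hb
    · obtain ⟨k, v, hv, hpath, i, j, hi, hj, hai, haj, hij⟩ := hb
      have hk : k ∈ Finset.range n := by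
        have := Fintype.card_le_of_injective v hv
        simp at this
        simpa using this
      refine le_trans ?_ (Finset.single_le_sum nn hk)
      have hmem : (v, i, j) ∈ (Finset.univ : Finset ((Fin (k + 1) → Fin n) × Fin (k + 1) × Fin (k + 1))).filter badV :=
        Finset.mem_filter.2 ⟨Finset.mem_univ _, hv, hi, hj, hij⟩
      refine le_trans ?_ (Finset.single_le_sum (fun x _ => ?_) hmem)
      · rw [if_pos]
        intro e he
        obtain ⟨e', he', rfl⟩ := Finset.mem_image.1 he
        simp only [Finset.mem_insert, Finset.mem_image, Finset.mem_univ, true_and] at he'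
        rcases he' with rfl | rfl | ⟨a, rfl⟩
        · exact ((SimpleGraph.fromEdgeSet_adj _).1 hai).1
        · exact ((SimpleGraph.fromEdgeSet_adj _).1 haj).1
        · exact ((SimpleGraph.fromEdgeSet_adj _).1 (hpath a)).1
      · split_ifs <;> norm_num
    · exact Finset.sum_nonneg nn
  refine step.trans ?_
  rw [Ex_sum]
  refine Finset.sum_le_sum fun k _ => ?_
  rw [Ex_sum]
  have : ∀ x ∈ (Finset.univ : Finset ((Fin (k + 1) → Fin n) × Fin (k + 1) × Fin (k + 1))).filter badV,
      Ex (UU n) p (fun s => if badT x.1 x.2.1 x.2.2 ⊆ s then 1 else 0) = p ^ (k + 2) := by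
    intro x hx
    obtain ⟨hv, hi, hj, hij⟩ := (Finset.mem_filter.1 hx).2
    rw [Ex_sup p (badT_sub hv hi hj), badT_card hv hi hj hij]
  rw [Finset.sum_congr rfl this, Finset.sum_const, nsmul_eq_mul]
  refine mul_le_mul_of_nonneg_right ?_ (by positivity)
  have h2 := Finset.card_filter_le (Finset.univ : Finset ((Fin (k + 1) → Fin n) × Fin (k + 1) × Fin (k + 1))) badV
  have h3 : (Finset.univ : Finset ((Fin (k + 1) → Fin n) × Fin (k + 1) × Fin (k + 1))).card
      = (k + 1) ^ 2 * n ^ (k + 1) := by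
    simp
    ring
  rw [h3] at h2
  exact_mod_cast h2

end first
end TwwAux

namespace TwwAux
open Finset

section tree
variable {n : ℕ}

lemma sum_update (ℓ : Fin 7) (F : (Fin 7 → Fin n) → ℝ) :
    ∑ ψ : Fin 7 → Fin n, ∑ a : Fin n, F (Function.update ψ ℓ a) = n * ∑ ψ, F ψ := by
  have h : ∑ x : (Fin 7 → Fin n) × Fin n, F (Function.update x.1 ℓ x.2)
      = ∑ x : (Fin 7 → Fin n) × Fin n, F x.1 := by
    refine Finset.sum_bij' (fun x _ => (Function.update x.1 ℓ x.2, x.1 ℓ))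
      (fun x _ => (Function.update x.1 ℓ x.2, x.1 ℓ)) ?_ ?_ ?_ ?_ ?_
    all_goals simp
  rw [Fintype.sum_prod_type, Fintype.sum_prod_type] at h
  rw [h, Finset.mul_sum]
  simp

def okL (r : Fin 7) : List (Fin 7 × Fin 7) → Bool
  | [] => true
  | e :: es => decide (e.1 ≠ e.2) && decide (e.2 ≠ r) &&
      decide (∀ e' ∈ es, e'.1 ≠ e.2 ∧ e'.2 ≠ e.2) && okL r es

lemma tree_sum (Q : Fin n → Fin n → ℝ) (hQ : ∀ x y, 0 ≤ Q x y) (D : ℝ) (hD0 : 0 ≤ D)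
    (hD : ∀ x, ∑ y, Q x y ≤ D) (r : Fin 7) (x : Fin n) :
    ∀ es : List (Fin 7 × Fin 7), okL r es = true →
      (n : ℝ) ^ es.length * ∑ ψ : Fin 7 → Fin n, (if ψ r = x then 1 else 0) *
          (es.map fun e => Q (ψ e.1) (ψ e.2)).prod
        ≤ D ^ es.length * ∑ ψ : Fin 7 → Fin n, (if ψ r = x then 1 else 0) := by
  intro es
  induction es with
  | nil => intro _; simp
  | cons e es ih =>
    intro h
    simp only [okL, Bool.and_eq_true, decide_eq_true_eq] at h
    obtain ⟨⟨⟨h1, h2⟩, h3⟩, h4⟩ := h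
    have ih := ih h4
    have key : (n : ℝ) * ∑ ψ : Fin 7 → Fin n, (if ψ r = x then 1 else 0) *
          ((e :: es).map fun e => Q (ψ e.1) (ψ e.2)).prod ≤
        D * ∑ ψ : Fin 7 → Fin n, (if ψ r = x then 1 else 0) *
          (es.map fun e => Q (ψ e.1) (ψ e.2)).prod := by
      rw [← sum_update e.2, Finset.mul_sum]
      refine Finset.sum_le_sum fun ψ _ => ?_
      have : ∀ a, (if (Function.update ψ e.2 a) r = x then (1:ℝ) else 0) *
          ((e :: es).map fun e' => Q ((Function.update ψ e.2 a) e'.1) ((Function.update ψ e.2 a) e'.2)).prod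
          = Q (ψ e.1) a * ((if ψ r = x then 1 else 0) * (es.map fun e => Q (ψ e.1) (ψ e.2)).prod) := by
        intro a
        have hm : (es.map fun e' => Q ((Function.update ψ e.2 a) e'.1) ((Function.update ψ e.2 a) e'.2))
            = es.map fun e => Q (ψ e.1) (ψ e.2) := by
          refine List.map_congr_left fun e' he' => ?_
          rw [Function.update_of_ne (h3 e' he').1, Function.update_of_ne (h3 e' he').2]
        rw [List.map_cons, List.prod_cons, hm, Function.update_of_ne h1, Function.update_self,
          Function.update_of_ne (Ne.symm h2)]
        ring
      simp_rw [this]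
      rw [← Finset.sum_mul]
      refine mul_le_mul_of_nonneg_right (hD _) (mul_nonneg (by split_ifs <;> norm_num) ?_)
      refine List.prod_nonneg fun z hz => ?_
      obtain ⟨e', _, rfl⟩ := List.mem_map.1 hz
      exact hQ _ _
    rw [List.length_cons, pow_succ, pow_succ, mul_assoc]
    calc _ ≤ (n : ℝ) ^ es.length * (D * ∑ ψ : Fin 7 → Fin n, (if ψ r = x then 1 else 0) *
          (es.map fun e => Q (ψ e.1) (ψ e.2)).prod) :=
          mul_le_mul_of_nonneg_left key (by positivity)
      _ = D * ((n : ℝ) ^ es.length * ∑ ψ : Fin 7 → Fin n, (if ψ r = x then 1 else 0) *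
          (es.map fun e => Q (ψ e.1) (ψ e.2)).prod) := by ring
      _ ≤ D * (D ^ es.length * ∑ ψ : Fin 7 → Fin n, (if ψ r = x then 1 else 0)) :=
          mul_le_mul_of_nonneg_left ih hD0
      _ = _ := by ring

def spT : Finset (Sym2 (Fin 7)) := {s(0,1), s(0,2), s(0,3), s(1,4), s(2,5), s(3,6)}
def spF : Finset (Sym2 (Fin 7)) := Finset.univ.filter (fun e => ¬ e.IsDiag ∧ e ∉ spT)

lemma spT_card : spT.card = 6 := by decide +kernel
lemma spF_card : spF.card = 15 := by decide +kernel

def ordL : Fin 7 → List (Fin 7 × Fin 7)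
  | 0 => [(1,4),(2,5),(3,6),(0,1),(0,2),(0,3)]
  | 1 => [(2,5),(3,6),(0,2),(0,3),(1,0),(1,4)]
  | 2 => [(1,4),(3,6),(0,1),(0,3),(2,0),(2,5)]
  | 3 => [(1,4),(2,5),(0,1),(0,2),(3,0),(3,6)]
  | 4 => [(2,5),(3,6),(0,2),(0,3),(1,0),(4,1)]
  | 5 => [(1,4),(3,6),(0,1),(0,3),(2,0),(5,2)]
  | 6 => [(1,4),(2,5),(0,1),(0,2),(3,0),(6,3)]

lemma ordL_ok : ∀ r, okL r (ordL r) = true := by decide +kernel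
lemma ordL_len : ∀ r, (ordL r).length = 6 := by decide +kernel
lemma ordL_val : ∀ r, (((ordL r).map fun e => s(e.1, e.2) : List (Sym2 (Fin 7))) : Multiset (Sym2 (Fin 7)))
  = spT.val := by decide +kernel

lemma prod_spT (q : Sym2 (Fin n) → ℝ) (ψ : Fin 7 → Fin n) (r : Fin 7) :
    ∏ e ∈ spT, q (Sym2.map ψ e) = ((ordL r).map fun e => q s(ψ e.1, ψ e.2)).prod := by
  rw [Finset.prod, ← ordL_val r, Multiset.map_coe, Multiset.prod_coe, List.map_map]
  rfl

lemma spider_sum (hn : 0 < n) (T : Finset (Sym2 (Fin n))) (hT : T.card ≤ 6) (p : ℝ) (h0 : 0 ≤ p)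
    (hp : n * p ≤ 1) (r : Fin 7) (x : Fin n) :
    ∑ ψ : Fin 7 → Fin n, (if ψ r = x then 1 else 0) *
      ∏ e ∈ spT, (if Sym2.map ψ e ∈ T then 1 else p) ≤ 7 ^ 6 := by
  have h := tree_sum (fun x y => if s(x,y) ∈ T then 1 else p)
    (fun x y => by split_ifs <;> linarith) 7 (by norm_num) (fun x => ?_) r x (ordL r) (ordL_ok r)
  · rw [ordL_len] at h
    have hb : (n : ℝ) * ∑ ψ : Fin 7 → Fin n, (if ψ r = x then (1:ℝ) else 0) = n ^ 7 := by
      rw [← sum_update r]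
      simp
    have hn' : (0:ℝ) < n := by exact_mod_cast hn
    have hb' : ∑ ψ : Fin 7 → Fin n, (if ψ r = x then (1:ℝ) else 0) = n ^ 6 := by
      apply mul_left_cancel₀ hn'.ne'
      rw [hb]; ring
    rw [hb', mul_comm] at h
    have h := le_of_mul_le_mul_right h (by positivity)
    refine le_trans (le_of_eq ?_) h
    refine Finset.sum_congr rfl fun ψ _ => ?_
    rw [prod_spT (fun e => if e ∈ T then 1 else p) ψ r]
  · have : ∀ y : Fin n, (if s(x,y) ∈ T then 1 else p) ≤ (if s(x,y) ∈ T then 1 else 0) + p := by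
      intro y; split_ifs <;> linarith
    refine (Finset.sum_le_sum fun y _ => this y).trans ?_
    rw [Finset.sum_add_distrib, Finset.sum_boole]
    have hc : (Finset.univ.filter (fun y => s(x,y) ∈ T)).card ≤ 6 := by
      refine le_trans (Finset.card_le_card_of_injOn (fun y => s(x,y)) ?_ ?_) hT
      · intro y hy
        simpa using hy
      · intro a _ b _ hab
        simp only [Sym2.eq_iff] at hab
        rcases hab with hab | hab
        · exact hab.2
        · exact hab.2.trans hab.1
    have hc' : ((Finset.univ.filter (fun y => s(x,y) ∈ T)).card : ℝ) ≤ 6 := by exact_mod_cast hc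
    simp only [Finset.sum_const, Finset.card_univ, Fintype.card_fin, nsmul_eq_mul]
    linarith

end tree

section second
variable {n : ℕ}

def TT (φ : Fin 7 → Fin n) : Finset (Sym2 (Fin n)) := spT.image (Sym2.map φ)
def FF (φ : Fin 7 → Fin n) : Finset (Sym2 (Fin n)) := spF.image (Sym2.map φ)

noncomputable def II (φ : Fin 7 → Fin n) (s : Finset (Sym2 (Fin n))) : ℝ :=
  if TT φ ⊆ s ∧ Disjoint (FF φ) s then 1 else 0

variable {φ ψ : Fin 7 → Fin n}

lemma TT_card (h : Function.Injective φ) : (TT φ).card = 6 := by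
  rw [TT, Finset.card_image_of_injective _ (Sym2.map.injective h), spT_card]
lemma FF_card (h : Function.Injective φ) : (FF φ).card = 15 := by
  rw [FF, Finset.card_image_of_injective _ (Sym2.map.injective h), spF_card]

lemma spT_nd : ∀ e ∈ spT, ¬ e.IsDiag := by decide +kernel

lemma TT_sub (h : Function.Injective φ) : TT φ ⊆ UU n := by
  intro e he
  obtain ⟨e', he', rfl⟩ := Finset.mem_image.1 he
  rw [mem_UU, Sym2.isDiag_map h]
  exact spT_nd e' he'

lemma FF_sub (h : Function.Injective φ) : FF φ ⊆ UU n := by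
  intro e he
  obtain ⟨e', he', rfl⟩ := Finset.mem_image.1 he
  rw [mem_UU, Sym2.isDiag_map h]
  exact ((Finset.mem_filter.1 he').2).1

lemma TF_disj (h : Function.Injective φ) : Disjoint (TT φ) (FF φ) := by
  rw [TT, FF, Finset.disjoint_image (Sym2.map.injective h), Finset.disjoint_left]
  intro e he he'
  exact ((Finset.mem_filter.1 he').2).2 he

lemma disj_images (A B : Finset (Sym2 (Fin 7))) (h : ∀ a r, ψ r ≠ φ a) :
    Disjoint (A.image (Sym2.map φ)) (B.image (Sym2.map ψ)) := by
  rw [Finset.disjoint_left]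
  intro e he he'
  obtain ⟨e1, _, rfl⟩ := Finset.mem_image.1 he
  obtain ⟨e2, _, h2⟩ := Finset.mem_image.1 he'
  induction e1 with | _ a b
  induction e2 with | _ c d
  simp only [Sym2.map_mk, Sym2.eq_iff] at h2
  rcases h2 with h2 | h2
  · exact h _ _ h2.1
  · exact h _ _ h2.1

lemma Ex_II (p : ℝ) (h : Function.Injective φ) : Ex (UU n) p (II φ) = p ^ 6 * (1 - p) ^ 15 := by
  have := Ex_cyl p (TT_sub h) (FF_sub h) (TF_disj h)
  rw [TT_card h, FF_card h] at this
  exact this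

lemma Ex_II_II (p : ℝ) (h0 : 0 ≤ p) (h1 : p ≤ 1) (h : Function.Injective φ) (h' : Function.Injective ψ) :
    Ex (UU n) p (fun s => II φ s * II ψ s) ≤ (p ^ 6 * (1 - p) ^ 15) ^ 2 +
      p ^ 6 * ∑ r, ∑ a, (if ψ r = φ a then 1 else 0) *
        ∏ e ∈ spT, (if Sym2.map ψ e ∈ TT φ then 1 else p) := by
  have hprod : 0 ≤ ∏ e ∈ spT, (if Sym2.map ψ e ∈ TT φ then 1 else p) :=
    Finset.prod_nonneg fun e _ => by split_ifs <;> linarith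
  by_cases hd : ∀ a r, ψ r ≠ φ a
  · have e1 : (fun s => II φ s * II ψ s) = fun s => if TT φ ∪ TT ψ ⊆ s ∧ Disjoint (FF φ ∪ FF ψ) s then 1 else 0 := by
      funext s
      unfold II
      simp only [Finset.union_subset_iff, Finset.disjoint_union_left]
      by_cases a1 : TT φ ⊆ s <;> by_cases a2 : TT ψ ⊆ s <;> by_cases a3 : Disjoint (FF φ) s <;>
        by_cases a4 : Disjoint (FF ψ) s <;> simp [a1, a2, a3, a4]
    have d1 : Disjoint (TT φ) (TT ψ) := disj_images _ _ hd
    have d2 : Disjoint (FF φ) (FF ψ) := disj_images _ _ hd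
    have hd' : ∀ a r, φ r ≠ ψ a := fun a r h => hd r a h.symm
    rw [e1, Ex_cyl p (Finset.union_subset (TT_sub h) (TT_sub h')) (Finset.union_subset (FF_sub h) (FF_sub h')),
      Finset.card_union_of_disjoint d1, Finset.card_union_of_disjoint d2,
      TT_card h, TT_card h', FF_card h, FF_card h']
    · have : 0 ≤ p ^ 6 * ∑ r, ∑ a, (if ψ r = φ a then 1 else 0) *
        ∏ e ∈ spT, (if Sym2.map ψ e ∈ TT φ then 1 else p) := by
        refine mul_nonneg (by positivity) (Finset.sum_nonneg fun r _ => Finset.sum_nonneg fun a _ =>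
          mul_nonneg (by split_ifs <;> norm_num) hprod)
      have e2 : p ^ (6 + 6) * (1 - p) ^ (15 + 15) = (p ^ 6 * (1 - p) ^ 15) ^ 2 := by ring
      linarith
    · rw [Finset.disjoint_union_left, Finset.disjoint_union_right, Finset.disjoint_union_right]
      exact ⟨⟨TF_disj h, disj_images _ _ hd⟩, disj_images _ _ hd', TF_disj h'⟩
  · push Not at hd
    obtain ⟨a, r, har⟩ := hd
    have l1 : Ex (UU n) p (fun s => II φ s * II ψ s) ≤ Ex (UU n) p (fun s => if TT φ ∪ TT ψ ⊆ s then 1 else 0) := by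
      refine Ex_mono h0 h1 fun s _ => ?_
      unfold II
      by_cases c1 : TT φ ⊆ s
      · by_cases c2 : TT ψ ⊆ s
        · rw [if_pos (Finset.union_subset c1 c2)]
          split_ifs <;> norm_num
        · rw [if_neg (fun h : TT ψ ⊆ s ∧ _ => c2 h.1)]
          split_ifs <;> norm_num
      · rw [if_neg (fun h : TT φ ⊆ s ∧ _ => c1 h.1)]
        split_ifs <;> norm_num
    have e3 : p ^ (TT ψ \ TT φ).card = ∏ e ∈ spT, (if Sym2.map ψ e ∈ TT φ then 1 else p) := by
      rw [← Finset.prod_image (s := spT) (g := Sym2.map ψ) (f := fun e => if e ∈ TT φ then 1 else p)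
        (fun a _ b _ hab => Sym2.map.injective h' hab)]
      change _ = ∏ e ∈ TT ψ, _
      rw [Finset.prod_ite]
      simp [Finset.sdiff_eq_filter]
    have e2 : Ex (UU n) p (fun s => if TT φ ∪ TT ψ ⊆ s then 1 else 0) =
        p ^ 6 * ∏ e ∈ spT, (if Sym2.map ψ e ∈ TT φ then 1 else p) := by
      rw [Ex_sup p (Finset.union_subset (TT_sub h) (TT_sub h')), ← Finset.union_sdiff_self_eq_union,
        Finset.card_union_of_disjoint Finset.disjoint_sdiff, pow_add, TT_card h, e3]
    rw [e2] at l1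
    refine l1.trans ?_
    have l2 : ∏ e ∈ spT, (if Sym2.map ψ e ∈ TT φ then 1 else p) ≤ ∑ r, ∑ a, (if ψ r = φ a then 1 else 0) *
        ∏ e ∈ spT, (if Sym2.map ψ e ∈ TT φ then 1 else p) := by
      refine le_trans ?_ (Finset.single_le_sum (fun r _ => Finset.sum_nonneg fun a _ =>
          mul_nonneg (by split_ifs <;> norm_num) hprod) (Finset.mem_univ r))
      refine le_trans ?_ (Finset.single_le_sum (fun a _ =>
          mul_nonneg (by split_ifs <;> norm_num) hprod) (Finset.mem_univ a))
      rw [if_pos har, one_mul]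
    have := mul_le_mul_of_nonneg_left l2 (pow_nonneg h0 6)
    have := sq_nonneg (p ^ 6 * (1 - p) ^ 15)
    linarith

open Classical in
noncomputable def inj7 (n : ℕ) : Finset (Fin 7 → Fin n) := Finset.univ.filter Function.Injective

lemma mem_inj7 : φ ∈ inj7 n ↔ Function.Injective φ := by simp [inj7]

lemma inj7_card (n : ℕ) : (inj7 n).card = n.descFactorial 7 := by
  classical
  have := Fintype.card_embedding_eq (α := Fin 7) (β := Fin n)
  simp only [Fintype.card_fin] at this
  rw [← this, inj7, ← Fintype.card_subtype]
  exact Fintype.card_congr (Equiv.subtypeInjectiveEquivEmbedding _ _)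

noncomputable def XX (s : Finset (Sym2 (Fin n))) : ℝ := ∑ φ ∈ inj7 n, II φ s

lemma second_moment (hn : 0 < n) (p : ℝ) (h0 : 0 ≤ p) (h1 : p ≤ 1) (hp : n * p ≤ 1) :
    Ex (UU n) p (fun s => XX s ^ 2) ≤ ((inj7 n).card * (p ^ 6 * (1 - p) ^ 15)) ^ 2 +
      (inj7 n).card * p ^ 6 * 7 ^ 8 := by
  have e1 : (fun s : Finset (Sym2 (Fin n)) => XX s ^ 2) =
      fun s => ∑ φ ∈ inj7 n, ∑ ψ ∈ inj7 n, II φ s * II ψ s := by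
    funext s
    rw [XX, sq, Finset.sum_mul_sum]
  rw [e1, Ex_sum]
  have : ∀ φ ∈ inj7 n, Ex (UU n) p (fun s => ∑ ψ ∈ inj7 n, II φ s * II ψ s) ≤
      (inj7 n).card * (p ^ 6 * (1 - p) ^ 15) ^ 2 + p ^ 6 * 7 ^ 8 := by
    intro φ hφ
    rw [Ex_sum]
    refine (Finset.sum_le_sum fun ψ hψ => Ex_II_II p h0 h1 (mem_inj7.1 hφ) (mem_inj7.1 hψ)).trans ?_
    rw [Finset.sum_add_distrib, Finset.sum_const, nsmul_eq_mul, ← Finset.mul_sum]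
    refine add_le_add le_rfl (mul_le_mul_of_nonneg_left ?_ (pow_nonneg h0 6))
    have nn : ∀ ψ : Fin 7 → Fin n, 0 ≤ ∑ r, ∑ a, (if ψ r = φ a then (1:ℝ) else 0) *
        ∏ e ∈ spT, (if Sym2.map ψ e ∈ TT φ then 1 else p) := fun ψ =>
      Finset.sum_nonneg fun r _ => Finset.sum_nonneg fun a _ =>
          mul_nonneg (by split_ifs <;> norm_num) (Finset.prod_nonneg fun e _ => by split_ifs <;> linarith)
    refine (Finset.sum_le_sum_of_subset_of_nonneg (Finset.subset_univ _) (fun ψ _ _ => nn ψ)).trans ?_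
    rw [Finset.sum_comm]
    have : ∀ r : Fin 7, ∑ ψ : Fin 7 → Fin n, ∑ a, (if ψ r = φ a then (1:ℝ) else 0) *
        ∏ e ∈ spT, (if Sym2.map ψ e ∈ TT φ then 1 else p) ≤ 7 ^ 7 := by
      intro r
      rw [Finset.sum_comm]
      refine (Finset.sum_le_sum fun a _ => spider_sum hn (TT φ) (TT_card (mem_inj7.1 hφ)).le p h0 hp r (φ a)).trans ?_
      simp
      norm_num
    refine (Finset.sum_le_sum fun r _ => this r).trans ?_
    simp
    norm_num
  refine (Finset.sum_le_sum this).trans ?_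
  rw [Finset.sum_const, nsmul_eq_mul]
  apply le_of_eq
  ring

lemma first_moment (p : ℝ) : Ex (UU n) p XX = (inj7 n).card * (p ^ 6 * (1 - p) ^ 15) := by
  have : (XX : Finset (Sym2 (Fin n)) → ℝ) = fun s => ∑ φ ∈ inj7 n, II φ s := rfl
  rw [this, Ex_sum, Finset.sum_congr rfl (fun φ hφ => Ex_II p (mem_inj7.1 hφ)), Finset.sum_const, nsmul_eq_mul]

open Classical in
lemma chebyshev (hn : 0 < n) (p : ℝ) (h0 : 0 ≤ p) (h1 : p ≤ 1) (hp : n * p ≤ 1) :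
    ((inj7 n).card * (p ^ 6 * (1 - p) ^ 15)) ^ 2 * Ex (UU n) p (fun s => if XX s = 0 then 1 else 0) ≤
      (inj7 n).card * p ^ 6 * 7 ^ 8 := by
  set μ := ((inj7 n).card * (p ^ 6 * (1 - p) ^ 15)) with hμ
  have l1 : Ex (UU n) p (fun s => μ ^ 2 * if XX s = 0 then 1 else 0) ≤
      Ex (UU n) p (fun s => (XX s ^ 2 + (-2 * μ) * XX s) + μ ^ 2) := by
    refine Ex_mono h0 h1 fun s _ => ?_
    split_ifs with h
    · rw [h]; simp
    · nlinarith [sq_nonneg (XX s - μ)]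
  rw [Ex_mul, Ex_add, Ex_add, Ex_mul, Ex_const, first_moment, ← hμ] at l1
  have := second_moment hn p h0 h1 hp
  rw [← hμ] at this
  nlinarith

lemma sp_mem : ∀ i j : Fin 7, spE i j = true → s(i,j) ∈ spT := by decide +kernel
lemma sp_notMem : ∀ i j : Fin 7, i ≠ j → ¬ spE i j = true → s(i,j) ∈ spF := by decide +kernel

lemma spider_of_XX {s : Finset (Sym2 (Fin n))} (h : XX s ≠ 0) :
    HasSpider (SimpleGraph.fromEdgeSet (s : Set (Sym2 (Fin n)))) := by
  obtain ⟨φ, hφ, hI⟩ := Finset.exists_ne_zero_of_sum_ne_zero h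
  have hi := mem_inj7.1 hφ
  have hc : TT φ ⊆ s ∧ Disjoint (FF φ) s := by
    by_contra hc
    exact hI (if_neg hc)
  refine ⟨φ, hi, fun i j hij => ?_⟩
  rw [SimpleGraph.fromEdgeSet_adj]
  constructor
  · rintro ⟨hs, _⟩
    by_contra hE
    refine Finset.disjoint_left.1 hc.2 (Finset.mem_image.2 ⟨s(i,j), sp_notMem i j hij hE, ?_⟩) hs
    rfl
  · intro hE
    refine ⟨hc.1 (Finset.mem_image.2 ⟨s(i,j), sp_mem i j hE, rfl⟩), hi.ne hij⟩

end second
end TwwAux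

namespace TwwAux
open Finset Filter Topology

open Classical in
lemma er_lower {n : ℕ} (hn : 0 < n) (p : ℝ) (h0 : 0 ≤ p) (h1 : p ≤ 1) :
    1 ≤ erProb n p {G : SimpleGraph (Fin n) | G.tww = 2} +
      (Ex (UU n) p (fun s => if Bad (SimpleGraph.fromEdgeSet (s : Set (Sym2 (Fin n)))) then 1 else 0)
        + Ex (UU n) p (fun s => if XX s = 0 then 1 else 0)) := by
  haveI : Nonempty (Fin n) := ⟨⟨0, hn⟩⟩
  rw [erProb_eq, ← Ex_add, ← Ex_add]
  refine le_trans (Ex_const (U := UU n) (p := p) 1).ge ?_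
  refine Ex_mono h0 h1 fun s _ => ?_
  by_cases hb : Bad (SimpleGraph.fromEdgeSet (s : Set (Sym2 (Fin n))))
  · rw [if_pos hb]
    split_ifs <;> norm_num
  · by_cases hx : XX s = 0
    · rw [if_pos hx]
      split_ifs <;> norm_num
    · have : (SimpleGraph.fromEdgeSet (s : Set (Sym2 (Fin n)))) ∈ {G : SimpleGraph (Fin n) | G.tww = 2} := by
        obtain ⟨f, hf⟩ := pseudoforest_of_not_bad _ hb
        exact tww_eq_two (W2_of_pseudoforest _ f hf) (spider_of_XX hx)
      rw [if_pos this, if_neg hb, if_neg hx]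
      norm_num

lemma er_upper (n : ℕ) (p : ℝ) (h0 : 0 ≤ p) (h1 : p ≤ 1) (A : Set (SimpleGraph (Fin n))) :
    erProb n p A ≤ 1 := by
  classical
  rw [erProb_eq]
  refine le_trans ?_ (Ex_const (U := UU n) (p := p) 1).le
  refine Ex_mono h0 h1 fun s _ => ?_
  split_ifs <;> norm_num

lemma first_lim (c : ℝ) (hc0 : 0 < c) (hc1 : c < 1) : ∃ S : ℝ, ∀ n : ℕ, 0 < n → ∀ p : ℝ, 0 ≤ p →
    p ≤ c / n → ∑ k ∈ Finset.range n, ((k : ℝ) + 1) ^ 2 * (n : ℝ) ^ (k + 1) * p ^ (k + 2) ≤ S / n := by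
  have hs : Summable (fun k : ℕ => ((k : ℝ) + 1) ^ 2 * c ^ (k + 2)) := by
    have h := summable_pow_mul_geometric_of_norm_lt_one (R := ℝ) 2 (r := c)
      (by rw [Real.norm_eq_abs, abs_of_pos hc0]; exact hc1)
    have h := ((summable_nat_add_iff 1).2 h).mul_left c
    refine h.congr fun k => ?_
    push_cast
    ring
  refine ⟨∑' k : ℕ, ((k : ℝ) + 1) ^ 2 * c ^ (k + 2), fun n hn p hp0 hp => ?_⟩
  have hn' : (0:ℝ) < n := by exact_mod_cast hn
  rw [le_div_iff₀ hn', Finset.sum_mul]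
  refine le_trans (Finset.sum_le_sum fun k _ => ?_) (hs.sum_le_tsum (Finset.range n) (fun k _ => by positivity))
  have h2 : p ^ (k + 2) ≤ (c / n) ^ (k + 2) := pow_le_pow_left₀ hp0 hp _
  calc ((k : ℝ) + 1) ^ 2 * (n : ℝ) ^ (k + 1) * p ^ (k + 2) * n
      = ((k : ℝ) + 1) ^ 2 * ((n : ℝ) ^ (k + 2) * p ^ (k + 2)) := by ring
    _ ≤ ((k : ℝ) + 1) ^ 2 * ((n : ℝ) ^ (k + 2) * (c / n) ^ (k + 2)) := by gcongr
    _ = _ := by rw [← mul_pow, mul_div_cancel₀ _ hn'.ne']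

open Classical in
lemma second_bound {n : ℕ} (hn : 12 ≤ n) (p : ℝ) (h0 : 0 < p) (hp : p ≤ 1 / n) :
    Ex (UU n) p (fun s => if XX s = 0 then 1 else 0) ≤ 7 ^ 8 * 2 ^ 37 / ((n : ℝ) ^ 7 * p ^ 6) := by
  have hn0 : 0 < n := by omega
  have hn' : (0:ℝ) < n := by exact_mod_cast hn0
  have hn12 : (12:ℝ) ≤ n := by exact_mod_cast hn
  have hnp : n * p ≤ 1 := by rwa [le_div_iff₀ hn', mul_comm] at hp
  have hp2 : p ≤ 1 / 2 := by nlinarith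
  have hch := chebyshev hn0 p h0.le (by linarith) hnp
  set P := Ex (UU n) p (fun s => if XX s = 0 then 1 else 0) with hP
  have hP0 : 0 ≤ P := by
    refine le_trans (Ex_const (U := UU n) (p := p) 0).ge (Ex_mono h0.le (by linarith) fun s _ => ?_)
    split_ifs <;> norm_num
  set N : ℝ := ((inj7 n).card : ℝ) with hN
  have hNl : ((n : ℝ) / 2) ^ 7 ≤ N := by
    have h := Nat.pow_sub_le_descFactorial n 7
    rw [← inj7_card] at h
    have h' : (((n + 1 - 7 : ℕ) : ℝ)) ^ 7 ≤ N := by rw [hN]; exact_mod_cast h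
    refine le_trans (pow_le_pow_left₀ (by positivity) ?_ 7) h'
    rw [Nat.cast_sub (by omega)]
    push_cast
    linarith
  have hNpos : 0 < N := lt_of_lt_of_le (by positivity) hNl
  have h3 : N * p ^ 6 * (1 - p) ^ 30 * P ≤ 7 ^ 8 := by
    have hpos : 0 < N * p ^ 6 := by positivity
    refine le_of_mul_le_mul_left ?_ hpos
    calc _ = (N * (p ^ 6 * (1 - p) ^ 15)) ^ 2 * P := by ring
      _ ≤ _ := hch
  have h4 : ((n:ℝ) / 2) ^ 7 * p ^ 6 * (1 / 2) ^ 30 * P ≤ N * p ^ 6 * (1 - p) ^ 30 * P := by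
    have : (1 / 2 : ℝ) ^ 30 ≤ (1 - p) ^ 30 := pow_le_pow_left₀ (by norm_num) (by linarith) 30
    gcongr
  rw [le_div_iff₀ (by positivity)]
  have h5 : ((n:ℝ) / 2) ^ 7 * p ^ 6 * (1 / 2) ^ 30 * P = P * ((n : ℝ) ^ 7 * p ^ 6) / 2 ^ 37 := by
    ring
  rw [h5] at h4
  have h6 := h4.trans h3
  rwa [div_le_iff₀ (by positivity)] at h6

end TwwAux

/-- **Theorem 5(3).** If `p(n)·n^{7/6} → ∞` and `p(n) ≤ c/n` for a constant `c ∈ (0,1)`,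
then a.a.s. `tww(G(n,p)) = 2`. -/
theorem tww_random_eq_two (c : ℝ) (hc0 : 0 < c) (hc1 : c < 1)
    (p : ℕ → ℝ) (hp01 : ∀ n, p n ∈ Set.Icc (0 : ℝ) 1)
    (hp₁ : Filter.Tendsto (fun n : ℕ => p n * (n : ℝ) ^ ((7 : ℝ) / 6))
      Filter.atTop Filter.atTop)
    (hp₂ : ∀ n : ℕ, 0 < n → p n ≤ c / (n : ℝ)) :
    Filter.Tendsto
      (fun n : ℕ => erProb n (p n) {G : SimpleGraph (Fin n) | G.tww = 2})
      Filter.atTop (nhds 1) := by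
  obtain ⟨S, hS⟩ := TwwAux.first_lim c hc0 hc1
  have hpow : ∀ n : ℕ, (p n * (n : ℝ) ^ ((7 : ℝ) / 6)) ^ 6 = (n : ℝ) ^ 7 * p n ^ 6 := by
    intro n
    rw [mul_pow, ← Real.rpow_natCast ((n:ℝ) ^ ((7:ℝ)/6)), ← Real.rpow_mul (Nat.cast_nonneg n), mul_comm]
    congr 1
    norm_num
  have hden : Filter.Tendsto (fun n : ℕ => (n : ℝ) ^ 7 * p n ^ 6) Filter.atTop Filter.atTop := by
    have := (Filter.tendsto_pow_atTop (α := ℝ) (n := 6) (by norm_num)).comp hp₁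
    refine this.congr fun n => hpow n
  have l2 : Filter.Tendsto (fun n : ℕ => (7:ℝ) ^ 8 * 2 ^ 37 / ((n : ℝ) ^ 7 * p n ^ 6)) Filter.atTop (nhds 0) :=
    hden.const_div_atTop _
  have l1 : Filter.Tendsto (fun n : ℕ => S / (n : ℝ)) Filter.atTop (nhds 0) :=
    tendsto_natCast_atTop_atTop.const_div_atTop _
  have l3 : Filter.Tendsto (fun n : ℕ => 1 - (S / (n : ℝ) + (7:ℝ) ^ 8 * 2 ^ 37 / ((n : ℝ) ^ 7 * p n ^ 6)))
      Filter.atTop (nhds 1) := by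
    simpa using (l1.add l2).const_sub 1
  refine tendsto_of_tendsto_of_tendsto_of_le_of_le' l3 tendsto_const_nhds ?_
    (Filter.Eventually.of_forall fun n => TwwAux.er_upper n (p n) (hp01 n).1 (hp01 n).2 _)
  filter_upwards [Filter.eventually_ge_atTop 12, hp₁.eventually_gt_atTop 0] with n hn hpos
  have hn0 : 0 < n := by omega
  have hn' : (0:ℝ) < n := by exact_mod_cast hn0
  have hp0 : 0 < p n := by
    rcases (hp01 n).1.lt_or_eq with h | h
    · exact h
    · rw [← h] at hpos
      simp at hpos
  have a1 := TwwAux.er_lower hn0 (p n) (hp01 n).1 (hp01 n).2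
  have a2 := (TwwAux.bad_bound n (p n) (hp01 n).1 (hp01 n).2).trans (hS n hn0 (p n) (hp01 n).1 (hp₂ n hn0))
  have a3 := TwwAux.second_bound hn (p n) hp0
    ((hp₂ n hn0).trans (div_le_div_of_nonneg_right hc1.le hn'.le))
  linarith
end

section
/- Let σ be a partial contraction sequence from a trigraph G to a trigraph G'. If v is a vertex of G' with |σ^{-1}(v)| = 1, then the red-degree of v in G' is at most the red-degree of v in G plus t, where t is the number of vertices w of G' with |σ^{-1}(w)| > 1. -/
namespace Trigraph

theorem aux_mem {V : Type*} [DecidableEq V] (L : List (V × V)) : ∀ (G : Trigraph V),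
    ∀ w, w ∈ (G.applySeq L).verts → w ∈ G.verts ∧ seqMap L w = w := by
  induction L with
  | nil => intro G w hw; exact ⟨hw, rfl⟩
  | cons p L ih =>
    intro G w hw
    obtain ⟨h1, h2⟩ := ih (G.contract p.1 p.2) w hw
    have h3 : w ∈ G.verts.erase p.2 := h1
    rw [Finset.mem_erase] at h3
    refine ⟨h3.2, ?_⟩
    change seqMap L (if w = p.2 then p.1 else w) = w
    rw [if_neg h3.1, h2]

theorem aux_red {V : Type*} [DecidableEq V] (L : List (V × V)) : ∀ (G : Trigraph V),
    G.ValidSeq L → ∀ v w, 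
    (∀ x ∈ G.verts, seqMap L x = v → x = v) → (∀ x ∈ G.verts, seqMap L x = w → x = w) →
    (G.applySeq L).Red v w → G.Red v w := by
  induction L with
  | nil => intro G _ v w _ _ h; exact h
  | cons p L ih =>
    intro G hL v w hv hw h
    obtain ⟨hp1, hp2, hne, hL'⟩ := hL
    have hs : ∀ x, seqMap (p :: L) x = seqMap L (if x = p.2 then p.1 else x) := fun _ => rfl
    have key : ∀ z, (∀ x ∈ G.verts, seqMap (p :: L) x = z → x = z) →
        (∀ x ∈ (G.contract p.1 p.2).verts, seqMap L x = z → x = z) := by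
      intro z hz x hx hxz
      have h3 : x ∈ G.verts.erase p.2 := hx
      rw [Finset.mem_erase] at h3
      apply hz x h3.2
      rw [hs, if_neg h3.1, hxz]
    have key2 : ∀ z, z ∈ (applySeq (G.contract p.1 p.2) L).verts →
        (∀ x ∈ G.verts, seqMap (p :: L) x = z → x = z) → z ≠ p.1 := by
      intro z hzm hz hzp
      have h1 := (aux_mem L _ z hzm).2
      have h2 := hz p.2 hp2 (by rw [hs, if_pos rfl, ← hzp, h1])
      exact hne (hzp.symm.trans h2.symm)
    have h' : (applySeq (G.contract p.1 p.2) L).Red v w := h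
    have hvn := key2 v (red_mem _ _ _ h') hv
    have hwn := key2 w (red_mem _ _ _ (red_symm _ _ _ h')) hw
    obtain ⟨_, _, _, h4⟩ := ih _ hL' v w (key v hv) (key w hw) h'
    rcases h4 with h4 | h4 | h4
    · exact absurd h4.1 hvn
    · exact absurd h4.1 hwn
    · exact h4.2.2

end Trigraph

open Trigraph in
/-- **Lemma 2.2.** Let `σ` be a partial contraction sequence from `G` to `G'`
(here given by the list `L` of contracted pairs, `G' = G.applySeq L`, with induced
map `seqMap L`). If `v` is a vertex of `G'` with `|σ⁻¹(v)| = 1`, then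
`rdeg_{G'}(v) ≤ rdeg_G(v) + t`, where `t` is the number of vertices `w` of `G'` with
`|σ⁻¹(w)| > 1`. -/
theorem redDeg_le_redDeg_add {V : Type*} [DecidableEq V] (G : Trigraph V)
    (L : List (V × V)) (hL : G.ValidSeq L) (v : V) (hv : v ∈ (G.applySeq L).verts)
    (hone : {x | x ∈ G.verts ∧ seqMap L x = v}.ncard = 1) (t : ℕ)
    (ht : t = {w | w ∈ (G.applySeq L).verts ∧
      1 < {x | x ∈ G.verts ∧ seqMap L x = w}.ncard}.ncard) :
    (G.applySeq L).redDeg v ≤ G.redDeg v + t := by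
  classical
  have fin : ∀ z, {x | x ∈ G.verts ∧ seqMap L x = z}.Finite := fun z =>
    G.verts.finite_toSet.subset fun x hx => hx.1
  have one : ∀ z ∈ (G.applySeq L).verts, {x | x ∈ G.verts ∧ seqMap L x = z}.ncard ≤ 1 →
      ∀ x ∈ G.verts, seqMap L x = z → x = z := by
    intro z hz hc x hx hxz
    exact (Set.ncard_le_one (fin z)).1 hc x ⟨hx, hxz⟩ z (aux_mem L G z hz)
  have f1 : {w | G.Red v w}.Finite :=
    G.verts.finite_toSet.subset fun x hx => G.red_mem _ _ (G.red_symm _ _ hx)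
  have f2 : {w | w ∈ (G.applySeq L).verts ∧
      1 < {x | x ∈ G.verts ∧ seqMap L x = w}.ncard}.Finite :=
    (G.applySeq L).verts.finite_toSet.subset fun x hx => hx.1
  rw [ht]
  refine le_trans (Set.ncard_le_ncard ?_ (f1.union f2)) (Set.ncard_union_le _ _)
  intro w hw
  have hwm := (G.applySeq L).red_mem _ _ ((G.applySeq L).red_symm _ _ hw)
  by_cases hc : 1 < {x | x ∈ G.verts ∧ seqMap L x = w}.ncard
  · exact Or.inr ⟨hwm, hc⟩
  · exact Or.inl (aux_red L G hL v w (one v hv hone.le) (one w hwm (not_lt.1 hc)) hw)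
end

section
/- Let a and b be nonnegative integers and t a positive integer with a + t > b. Then binom(a+b, a+t) · (a+t)^t ≤ b^t · binom(a+b, a); equivalently, the proportion of North-East lattice paths from (0,0) to (a,b) that intersect the line y = x + t is at most (b/(a+t))^t. -/
theorem descFactorial_mul_pow_le_aux (b c : ℕ) (h : b ≤ c) (t : ℕ) :
    b.descFactorial t * c ^ t ≤ b ^ t * c.descFactorial t := by
  induction t with
  | zero => simp
  | succ t ih =>
    have key : (b - t) * c ≤ b * (c - t) := by
      rw [Nat.sub_mul, Nat.mul_sub]
      have : b * t ≤ t * c := by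
        rw [mul_comm]
        exact Nat.mul_le_mul_left t h
      omega
    rw [Nat.descFactorial_succ, Nat.descFactorial_succ, pow_succ, pow_succ]
    calc (b - t) * b.descFactorial t * (c ^ t * c)
        = ((b - t) * c) * (b.descFactorial t * c ^ t) := by ring
      _ ≤ (b * (c - t)) * (b ^ t * c.descFactorial t) := Nat.mul_le_mul key ih
      _ = _ := by ring

/-- **Corollary 2.4.** For nonnegative integers `a`, `b` and a positive integer `t` with
`a + t > b`, we have `binom(a+b, a+t) · (a+t)^t ≤ b^t · binom(a+b, a)`; equivalently, the
proportion of North-East lattice paths from `(0,0)` to `(a,b)` that intersect the line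
`y = x + t` is at most `(b/(a+t))^t`. -/
theorem choose_mul_pow_le (a b t : ℕ) (ht : 0 < t) (hab : b < a + t) :
    (a + b).choose (a + t) * (a + t) ^ t ≤ b ^ t * (a + b).choose a := by
  rcases Nat.lt_or_ge b t with hbt | hbt
  · rw [Nat.choose_eq_zero_of_lt (by omega)]
    simp
  have h1 := Nat.choose_mul (n := a + b) (k := a + t) (s := a) (by omega)
  rw [Nat.add_sub_cancel_left, Nat.add_sub_cancel_left, Nat.choose_symm_add] at h1
  have h2 : (a + b).choose (a + t) * (a + t).descFactorial t
      = (a + b).choose a * b.descFactorial t := by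
    rw [Nat.descFactorial_eq_factorial_mul_choose, Nat.descFactorial_eq_factorial_mul_choose,
      mul_left_comm, h1, mul_left_comm]
  have h3 := descFactorial_mul_pow_le_aux b (a + t) hab.le t
  have hpos : 0 < (a + t).descFactorial t := Nat.descFactorial_pos.2 (by omega)
  refine Nat.le_of_mul_le_mul_right ?_ hpos
  calc (a + b).choose (a + t) * (a + t) ^ t * (a + t).descFactorial t
      = ((a + b).choose (a + t) * (a + t).descFactorial t) * (a + t) ^ t := by ring
    _ = (a + b).choose a * (b.descFactorial t * (a + t) ^ t) := by rw [h2]; ring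
    _ ≤ (a + b).choose a * (b ^ t * (a + t).descFactorial t) := Nat.mul_le_mul_left _ h3
    _ = _ := by ring
end

section
/- Every conference graph on n vertices has twin-width at least (n−1)/2. -/
theorem Trigraph.exists_seq {V : Type*} [DecidableEq V] (k : ℕ) :
    ∀ G : Trigraph V, G.verts.card = k + 1 →
      ∃ L : List (V × V), G.ValidSeq L ∧ (G.applySeq L).verts.card = 1 := by
  induction k with
  | zero => intro G h; exact ⟨[], trivial, h⟩
  | succ k ih =>
    intro G h
    obtain ⟨a, ha, b, hb, hab⟩ := Finset.one_lt_card.mp (show 1 < G.verts.card by omega)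
    obtain ⟨L, h1, h2⟩ := ih (G.contract a b) (by
      change (G.verts.erase b).card = k + 1
      rw [Finset.card_erase_of_mem hb]; omega)
    exact ⟨(a, b) :: L, ⟨ha, hb, hab, h1⟩, h2⟩

open scoped Classical in
/-- Every conference graph on `n` vertices (an `(n−1)/2`-regular graph with `n ≡ 1 (mod 4)`
in which adjacent vertices have `(n−5)/4` common neighbors and nonadjacent vertices have
`(n−1)/4` common neighbors) has twin-width at least `(n−1)/2`. -/
theorem conferenceGraph_tww_lower {V : Type*} [Fintype V] [DecidableEq V]
    (G : SimpleGraph V) (n : ℕ) (hn : Fintype.card V = n) (hmod : n % 4 = 1)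
    (hreg : ∀ v : V, (G.neighborSet v).ncard = (n - 1) / 2)
    (hcommon : ∀ v w : V, v ≠ w → (G.neighborSet v ∩ G.neighborSet w).ncard =
      if G.Adj v w then (n - 5) / 4 else (n - 1) / 4) :
    (n - 1) / 2 ≤ G.tww := by
  rcases Nat.lt_or_ge n 2 with hlt | hge
  · have : (n - 1) / 2 = 0 := by omega
    omega
  have hne : {d : ℕ | ∃ L : List (V × V), G.toTrigraph.ValidSeq L ∧
      (G.toTrigraph.applySeq L).verts.card = 1 ∧
      ∀ L' : List (V × V), L' <+: L → ∀ v, (G.toTrigraph.applySeq L').redDeg v ≤ d}.Nonempty := by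
    obtain ⟨L, h1, h2⟩ := Trigraph.exists_seq (n - 1) G.toTrigraph (by
      change (Finset.univ : Finset V).card = _
      rw [Finset.card_univ]; omega)
    refine ⟨Nat.card V, L, h1, h2, fun L' _ v => ?_⟩
    exact Set.ncard_le_card _
  refine le_csInf hne ?_
  rintro d ⟨L, hv, hc, hd⟩
  match L, hv, hc, hd with
  | [], _, hc, _ =>
    exfalso
    change (Finset.univ : Finset V).card = 1 at hc
    rw [Finset.card_univ] at hc; omega
  | (u, v) :: L, hv, hc, hd =>
    obtain ⟨-, -, huv, -⟩ := hv
    have huv : u ≠ v := huv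
    refine le_trans ?_ (hd [(u, v)] ⟨L, rfl⟩ u)
    have hsub : ((G.neighborSet u \ G.neighborSet v) ∪ (G.neighborSet v \ G.neighborSet u)) \ {u, v}
        ⊆ {w | (G.toTrigraph.applySeq [(u, v)]).Red u w} := by
      rintro w ⟨hw, hw2⟩
      simp only [Set.mem_insert_iff, Set.mem_singleton_iff, not_or] at hw2
      refine ⟨Finset.mem_erase.2 ⟨huv, Finset.mem_univ _⟩,
        Finset.mem_erase.2 ⟨hw2.2, Finset.mem_univ _⟩, Ne.symm hw2.1, Or.inl ⟨rfl, ?_, ?_⟩⟩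
      · rcases hw with hw | hw
        · exact Or.inl (Or.inl hw.1)
        · exact Or.inr (Or.inl hw.1)
      · rintro ⟨h1, h2⟩
        rcases hw with hw | hw
        · exact hw.2 h2
        · exact hw.2 h1
    refine le_trans ?_ (Set.ncard_le_ncard hsub (Set.toFinite _))
    have e1 := Set.ncard_inter_add_ncard_sdiff_eq_ncard (G.neighborSet u) (G.neighborSet v) (Set.toFinite _)
    have e2 := Set.ncard_inter_add_ncard_sdiff_eq_ncard (G.neighborSet v) (G.neighborSet u) (Set.toFinite _)
    have e3 := Set.ncard_union_eq (s := G.neighborSet u \ G.neighborSet v)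
      (t := G.neighborSet v \ G.neighborSet u)
      (Set.disjoint_left.2 fun x hx hy => hx.2 hy.1) (Set.toFinite _) (Set.toFinite _)
    rw [Set.inter_comm] at e2
    have h1 := hreg u
    have h2 := hreg v
    have h3 := hcommon u v huv
    by_cases hadj : G.Adj u v
    · rw [if_pos hadj] at h3
      have e4 := Set.le_ncard_sdiff ({u, v} : Set V)
        ((G.neighborSet u \ G.neighborSet v) ∪ (G.neighborSet v \ G.neighborSet u)) (Set.toFinite _)
      have e5 := Set.ncard_pair huv
      omega
    · rw [if_neg hadj] at h3
      have e4 : ((G.neighborSet u \ G.neighborSet v) ∪ (G.neighborSet v \ G.neighborSet u)) \ {u, v}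
          = (G.neighborSet u \ G.neighborSet v) ∪ (G.neighborSet v \ G.neighborSet u) := by
        refine sdiff_eq_left.2 (Set.disjoint_left.2 ?_)
        have hadj' : ¬ G.Adj v u := fun h => hadj h.symm
        rintro x hx hy
        rcases hy with rfl | rfl
        · rcases hx with hx | hx
          · exact G.loopless.irrefl _ hx.1
          · exact hadj' hx.1
        · rcases hx with hx | hx
          · exact hadj hx.1
          · exact G.loopless.irrefl _ hx.1
      rw [e4]
      omega
end

section
/- For every graph G on n vertices, every subset L of V(G) with |L| ≥ 2 contains two distinct vertices u and v such that |(N_G(u) △ N_G(v)) \ {u,v}| ≤ n/2 + (n−1)/(2|L|−2) − 1. -/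
/-- **Proposition 4.1.** For every graph `G` on `n` vertices, every set `L` of at least two
vertices contains distinct vertices `u, v` with
`|(N(u) △ N(v)) \ {u,v}| ≤ n/2 + (n−1)/(2|L|−2) − 1`. -/
theorem exists_pair_small_symmDiff {V : Type*} [Fintype V] (G : SimpleGraph V)
    (n : ℕ) (hn : Fintype.card V = n) (L : Finset V) (hL : 2 ≤ L.card) :
    ∃ u ∈ L, ∃ v ∈ L, u ≠ v ∧
      (((symmDiff (G.neighborSet u) (G.neighborSet v) \ {u, v}).ncard : ℝ) ≤
        (n : ℝ) / 2 + ((n : ℝ) - 1) / (2 * (L.card : ℝ) - 2) - 1) := by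
  classical
  by_contra! hcon
  set B : ℝ := (n : ℝ) / 2 + ((n : ℝ) - 1) / (2 * (L.card : ℝ) - 2) - 1 with hB
  clear_value B
  let t : V → V → ℝ := fun w u => if u = w then 0 else 1
  let s : V → V → ℝ := fun w u => if u = w then 0 else if G.Adj u w then 1 else -1
  have hD : ∀ u v : V, u ≠ v →
      ((symmDiff (G.neighborSet u) (G.neighborSet v) \ {u, v}).ncard : ℝ)
        = ∑ w, (t w u * t w v - s w u * s w v) / 2 := by
    intro u v _
    rw [Set.ncard_eq_toFinset_card', Finset.card_eq_sum_ones, Nat.cast_sum,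
      ← Finset.sum_filter_add_sum_filter_not Finset.univ
        (fun w => w ∈ (symmDiff (G.neighborSet u) (G.neighborSet v) \ {u, v} : Set V))]
    rw [Finset.sum_eq_zero (s := Finset.univ.filter (fun w => ¬ _)), add_zero]
    · apply Finset.sum_congr
      · ext w
        rw [Set.mem_toFinset, Finset.mem_filter]
        exact ⟨fun h => ⟨Finset.mem_univ _, h⟩, fun h => h.2⟩
      · intro w hw
        rw [Finset.mem_filter] at hw
        replace hw := hw.2
        simp only [Set.mem_sdiff, Set.mem_symmDiff,
          SimpleGraph.mem_neighborSet, Set.mem_insert_iff, Set.mem_singleton_iff, not_or] at hw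
        obtain ⟨h1, h2, h3⟩ := hw
        have h2' := Ne.symm h2
        have h3' := Ne.symm h3
        rcases h1 with ⟨a, b⟩ | ⟨a, b⟩ <;> simp [t, s, h2', h3', a, b] <;> norm_num
    · intro w hw
      simp only [Finset.mem_filter, Finset.mem_univ, true_and, Set.mem_sdiff, Set.mem_symmDiff,
          SimpleGraph.mem_neighborSet, Set.mem_insert_iff, Set.mem_singleton_iff, not_or] at hw
      by_cases h2 : u = w
      · simp [t, s, h2]
      by_cases h3 : v = w
      · simp [t, s, h3]
      have h2' := Ne.symm h2
      have h3' := Ne.symm h3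
      by_cases a : G.Adj u w <;> by_cases b : G.Adj v w <;> simp_all [t, s]
  have hl : (2 : ℝ) ≤ L.card := by exact_mod_cast hL
  have hlow : ∑ p ∈ L.offDiag, B < ∑ p ∈ L.offDiag, ∑ w, (t w p.1 * t w p.2 - s w p.1 * s w p.2) / 2 := by
    apply Finset.sum_lt_sum_of_nonempty
    · obtain ⟨a, ha, b, hb, hab⟩ := Finset.one_lt_card.mp hL
      exact ⟨(a, b), by simp [ha, hb, hab]⟩
    · intro p hp
      rw [Finset.mem_offDiag] at hp
      rw [← hD _ _ hp.2.2]
      exact hcon _ hp.1 _ hp.2.1 hp.2.2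
  have hsub : ∑ p ∈ L.offDiag, ∑ w, (t w p.1 * t w p.2 - s w p.1 * s w p.2) / 2
      = ∑ p ∈ L ×ˢ L, ∑ w, (t w p.1 * t w p.2 - s w p.1 * s w p.2) / 2 := by
    apply Finset.sum_subset
    · intro p hp
      rw [Finset.mem_offDiag] at hp
      simp [hp.1, hp.2.1]
    · intro p hp hp'
      rw [Finset.mem_product] at hp
      have : p.1 = p.2 := by
        by_contra h
        exact hp' (Finset.mem_offDiag.2 ⟨hp.1, hp.2, h⟩)
      rw [this]
      apply Finset.sum_eq_zero
      intro w _
      simp only [t, s]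
      split_ifs <;> norm_num
  have hw : ∀ w, ∑ p ∈ L ×ˢ L, (t w p.1 * t w p.2 - s w p.1 * s w p.2) / 2
      ≤ ((L.card : ℝ) ^ 2 - (2 * L.card - 1) * (if w ∈ L then 1 else 0)) / 2 := by
    intro w
    have h1 : ∑ u ∈ L, t w u = (L.card : ℝ) - if w ∈ L then 1 else 0 := by
      have : ∀ u, t w u = 1 - (if u = w then (1 : ℝ) else 0) := by
        intro u; simp only [t]; split_ifs <;> norm_num
      simp [this]
    rw [← Finset.sum_div, Finset.sum_sub_distrib, Finset.sum_product, Finset.sum_product,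
      ← Finset.sum_mul_sum, ← Finset.sum_mul_sum, h1]
    have := mul_self_nonneg (∑ u ∈ L, s w u)
    split_ifs <;> nlinarith
  rw [hsub, Finset.sum_comm] at hlow
  have hup := hlow.trans_le (Finset.sum_le_sum fun w _ => hw w)
  rw [← Finset.sum_div, Finset.sum_sub_distrib, ← Finset.mul_sum] at hup
  simp only [Finset.sum_const, Finset.card_univ, hn, Finset.offDiag_card, nsmul_eq_mul,
    Finset.sum_ite_mem, Finset.univ_inter, mul_one] at hup
  rw [Nat.cast_sub (Nat.le_mul_self _)] at hup
  push_cast at hup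
  have : ((L.card : ℝ) * L.card - L.card) * B
      = (n * (L.card : ℝ) ^ 2 - (2 * L.card - 1) * L.card) / 2 := by
    rw [hB]
    have h0 : (L.card : ℝ) - 1 ≠ 0 := by linarith
    rw [show 2 * (L.card : ℝ) - 2 = 2 * ((L.card : ℝ) - 1) by ring]
    field_simp
    ring
  linarith
end

section
/- Every graph G on n ≥ 2 vertices has two distinct vertices v and w such that |(N_G(v) △ N_G(w)) \ {v,w}| ≤ (n−1)/2. -/
/-- **Corollary 4.2.** Every graph `G` on `n ≥ 2` vertices has distinct vertices `v, w` with
`|(N(v) △ N(w)) \ {v,w}| ≤ (n−1)/2`. -/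
theorem exists_pair_symmDiff_le {V : Type*} [Fintype V] (G : SimpleGraph V)
    (n : ℕ) (hn : Fintype.card V = n) (h2 : 2 ≤ n) :
    ∃ v w : V, v ≠ w ∧
      (((symmDiff (G.neighborSet v) (G.neighborSet w) \ {v, w}).ncard : ℝ) ≤
        ((n : ℝ) - 1) / 2) := by
  classical
  by_contra! hcon
  let a : V → V → ℝ := fun u v => if G.Adj u v then 1 else 0
  let b : V → V → ℝ := fun u v => if v ≠ u ∧ ¬ G.Adj u v then 1 else 0
  have hc : ∀ v w : V, ((symmDiff (G.neighborSet v) (G.neighborSet w) \ {v, w}).ncard : ℝ)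
      = ∑ u, (a u v * b u w + b u v * a u w) := by
    intro v w
    rw [Set.ncard_eq_toFinset_card', Finset.card_eq_sum_ones, Nat.cast_sum,
      ← Finset.sum_subset (Finset.subset_univ _)]
    · refine Finset.sum_congr rfl fun u hu => ?_
      simp only [Set.mem_toFinset, Set.mem_diff, Set.mem_symmDiff, SimpleGraph.mem_neighborSet,
        Set.mem_insert_iff, Set.mem_singleton_iff, G.adj_comm v u, G.adj_comm w u] at hu
      simp only [a, b]
      by_cases h1 : G.Adj u v <;> by_cases h3 : G.Adj u w <;> simp_all <;> grind
    · intro u _ hu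
      simp only [Set.mem_toFinset, Set.mem_diff, Set.mem_symmDiff, SimpleGraph.mem_neighborSet,
        Set.mem_insert_iff, Set.mem_singleton_iff, G.adj_comm v u, G.adj_comm w u] at hu
      simp only [a, b]
      have h5 := G.loopless.irrefl u
      by_cases h1 : G.Adj u v <;> by_cases h3 : G.Adj u w <;> simp_all <;> grind [G.ne_of_adj]
  have hab : ∀ u, ∑ v, a u v + ∑ v, b u v = (n : ℝ) - 1 := by
    intro u
    have : ∀ v, a u v + b u v = 1 - (if v = u then 1 else 0) := by
      intro v
      have h5 := G.loopless.irrefl u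
      simp only [a, b]
      by_cases h1 : v = u
      · subst h1; simp
      · by_cases h3 : G.Adj u v <;> simp [h1, h3]
    rw [← Finset.sum_add_distrib, Finset.sum_congr rfl fun v _ => this v]
    simp [Finset.sum_sub_distrib, hn]
  have hS : ∑ v, ∑ w, ∑ u, (a u v * b u w + b u v * a u w) ≤ n * (((n : ℝ) - 1) ^ 2 / 2) := by
    have h1 : ∑ v, ∑ w, ∑ u, (a u v * b u w + b u v * a u w)
        = ∑ u, 2 * ((∑ v, a u v) * ∑ v, b u v) := by
      rw [Finset.sum_congr rfl fun v _ => Finset.sum_comm, Finset.sum_comm]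
      refine Finset.sum_congr rfl fun u _ => ?_
      simp only [Finset.sum_add_distrib, ← Finset.mul_sum, ← Finset.sum_mul]
      ring
    rw [h1]
    have : ∀ u ∈ Finset.univ, 2 * ((∑ v, a u v) * ∑ v, b u v) ≤ ((n : ℝ) - 1) ^ 2 / 2 := by
      intro u _
      rw [← hab u]
      nlinarith [sq_nonneg ((∑ v, a u v) - ∑ v, b u v)]
    have := Finset.sum_le_card_nsmul _ _ _ this
    simpa [hn] using this
  simp only [← hc] at hS
  have hne : Nonempty V := Fintype.card_pos_iff.mp (by omega)
  have hL : ∑ v : V, ∑ w : V, (((n : ℝ) - 1) / 2) * (1 - if w = v then 1 else 0)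
      < ∑ v, ∑ w, ((symmDiff (G.neighborSet v) (G.neighborSet w) \ {v, w}).ncard : ℝ) := by
    refine Finset.sum_lt_sum_of_nonempty Finset.univ_nonempty fun v _ => ?_
    have : Nontrivial V := Fintype.one_lt_card_iff_nontrivial.mp (by omega)
    obtain ⟨w, hw⟩ := exists_ne v
    refine Finset.sum_lt_sum (fun x _ => ?_) ⟨w, Finset.mem_univ _, ?_⟩
    · by_cases h : x = v
      · simp [h]
      · simpa [h] using (hcon v x (Ne.symm h)).le
    · simpa [hw] using hcon v w hw.symm
  simp only [← Finset.mul_sum, Finset.sum_sub_distrib] at hL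
  simp [hn] at hL
  nlinarith
end

section
/- Let G be a graph on n ≥ 2 vertices and let p_1, ..., p_s be pairwise disjoint 2-element subsets of V(G). For each i ∈ [s], let v_i denote the new vertex of G/p_i, and let x_i : [s] → {−1, 0, 1} be defined by x_i(j) = rdeg_{G/p_i/p_j}(v_i) − rdeg_{G/p_i}(v_i) if i ≠ j, and x_i(i) = 0. Then the twin-width of G is at most the maximum of the set {n − s − 1} ∪ { rdeg_{G/p_i}(v_i) + Σ_{k=1}^{j} x_i(k) : 1 ≤ i ≤ j ≤ s−1 }. -/
namespace TwwAux

open Trigraph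

variable {V : Type*} [DecidableEq V]

def Good (H : Trigraph V) (d : ℕ) : Prop :=
  ∃ L : List (V × V), H.ValidSeq L ∧ (H.applySeq L).verts.card = 1 ∧
    ∀ L' : List (V × V), L' <+: L → ∀ v, (H.applySeq L').redDeg v ≤ d

theorem good_one (H : Trigraph V) (d : ℕ) (hc : H.verts.card = 1)
    (hr : ∀ v, H.redDeg v ≤ d) : Good H d := by
  refine ⟨[], trivial, hc, ?_⟩
  intro L' hL' v
  rw [List.prefix_nil] at hL'
  subst hL'
  exact hr v

theorem good_step (H : Trigraph V) (d : ℕ) (u v : V) (hu : u ∈ H.verts) (hv : v ∈ H.verts)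
    (huv : u ≠ v) (hr : ∀ v, H.redDeg v ≤ d) (hg : Good (H.contract u v) d) : Good H d := by
  obtain ⟨L, h1, h2, h3⟩ := hg
  refine ⟨(u, v) :: L, ⟨hu, hv, huv, h1⟩, h2, ?_⟩
  intro L' hL' w
  rw [List.prefix_cons_iff] at hL'
  rcases hL' with rfl | ⟨t, rfl, ht⟩
  · exact hr w
  · exact h3 t ht w

theorem red_lt (H : Trigraph V) (v : V) : H.redDeg v ≤ H.verts.card - 1 := by
  unfold redDeg
  by_cases hv : v ∈ H.verts
  · rw [← Finset.card_erase_of_mem hv, ← Set.ncard_coe_finset]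
    apply Set.ncard_le_ncard
    · intro w hw
      have hw : H.Red v w := hw
      simp only [Finset.coe_erase, Set.mem_diff, Finset.mem_coe, Set.mem_singleton_iff]
      exact ⟨H.red_mem _ _ (H.red_symm _ _ hw), (H.red_ne _ _ hw).symm⟩
    · exact Finset.finite_toSet _
  · have : {w | H.Red v w} = ∅ := by
      ext w
      simp only [Set.mem_setOf_eq, Set.mem_empty_iff_false, iff_false]
      exact fun h => hv (H.red_mem _ _ h)
    rw [this]; simp

theorem good_small (m d : ℕ) (hm : m ≤ d) : ∀ H : Trigraph V, H.verts.card = m + 1 → Good H d := by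
  induction m with
  | zero =>
    intro H hc
    exact good_one H d hc (fun v => by have := red_lt H v; omega)
  | succ m ih =>
    intro H hc
    obtain ⟨u, hu, v, hv, huv⟩ := Finset.one_lt_card.1 (by omega : 1 < H.verts.card)
    refine good_step H d u v hu hv huv (fun v => by have := red_lt H v; omega) ?_
    apply ih (by omega)
    show (H.verts.erase v).card = m + 1
    rw [Finset.card_erase_of_mem hv]; omega

/-- class of a vertex after contracting the pairs in `S` -/
def Cl (p : ℕ → V × V) (S : Finset ℕ) (x a : V) : Prop :=
  a = x ∨ ∃ k ∈ S, (p k).1 = x ∧ (p k).2 = a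

def Ok (p : ℕ → V × V) (S : Finset ℕ) (x : V) : Prop := ∀ k ∈ S, x ≠ (p k).2

def BlackS (G : SimpleGraph V) (p : ℕ → V × V) (S : Finset ℕ) (x y : V) : Prop :=
  Ok p S x ∧ Ok p S y ∧ x ≠ y ∧ ∀ a b, Cl p S x a → Cl p S y b → G.Adj a b

def RedS (G : SimpleGraph V) (p : ℕ → V × V) (S : Finset ℕ) (x y : V) : Prop :=
  Ok p S x ∧ Ok p S y ∧ x ≠ y ∧ (∃ a b, Cl p S x a ∧ Cl p S y b ∧ G.Adj a b) ∧
    (∃ a b, Cl p S x a ∧ Cl p S y b ∧ ¬ G.Adj a b)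

structure Rep [Fintype V] (G : SimpleGraph V) (p : ℕ → V × V) (S : Finset ℕ) (H : Trigraph V) :
    Prop where
  card : H.verts.card + S.card = Fintype.card V
  verts : ∀ x, x ∈ H.verts ↔ Ok p S x
  black : ∀ x y, H.Black x y ↔ BlackS G p S x y
  red : ∀ x y, H.Red x y ↔ RedS G p S x y

variable [Fintype V] (G : SimpleGraph V) (s : ℕ) (p : ℕ → V × V)

def Pairs (s : ℕ) (p : ℕ → V × V) : Prop :=
  (∀ i ∈ Finset.Icc 1 s, (p i).1 ≠ (p i).2) ∧
  ∀ i ∈ Finset.Icc 1 s, ∀ j ∈ Finset.Icc 1 s, i ≠ j →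
    (p i).1 ≠ (p j).1 ∧ (p i).1 ≠ (p j).2 ∧ (p i).2 ≠ (p j).1 ∧ (p i).2 ≠ (p j).2

theorem rep_empty : Rep G p ∅ G.toTrigraph := by
  constructor <;> simp [SimpleGraph.toTrigraph, Ok, BlackS, RedS, Cl]
  · intro x y h; exact h.ne

variable {G s p}

theorem Rep.contract (hp : Pairs s p) {S : Finset ℕ} (hS : S ⊆ Finset.Icc 1 s) {m : ℕ}
    (hm : m ∈ Finset.Icc 1 s) (hmS : m ∉ S) {H : Trigraph V} (h : Rep G p S H) :
    Rep G p (insert m S) (H.contract (p m).1 (p m).2) := by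
  obtain ⟨hp1, hp2⟩ := hp
  have hne := hp1 m hm
  have hq : ∀ k ∈ S, (p k).1 ≠ (p m).1 ∧ (p k).1 ≠ (p m).2 ∧ (p k).2 ≠ (p m).1 ∧
      (p k).2 ≠ (p m).2 := fun k hk => hp2 k (hS hk) m hm (fun e => hmS (e ▸ hk))
  have hv : (p m).2 ∈ H.verts := (h.verts _).2 fun k hk => (hq k hk).2.2.2.symm
  have hu : (p m).1 ∈ H.verts := (h.verts _).2 fun k hk => (hq k hk).2.2.1.symm
  have ok : ∀ x, Ok p (insert m S) x ↔ x ≠ (p m).2 ∧ Ok p S x := by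
    intro x; simp [Ok]
  have c1 : ∀ a, Cl p (insert m S) (p m).1 a ↔ a = (p m).1 ∨ a = (p m).2 := by
    intro a
    simp only [Cl, Finset.mem_insert, exists_eq_or_imp, true_and]
    constructor
    · rintro (h | h | ⟨k, hk, h, -⟩)
      · exact Or.inl h
      · exact Or.inr h.symm
      · exact absurd h (hq k hk).1
    · rintro (h | h)
      · exact Or.inl h
      · exact Or.inr (Or.inl h.symm)
  have c2 : ∀ x a, x ≠ (p m).1 → (Cl p (insert m S) x a ↔ Cl p S x a) := by
    intro x a hx
    simp only [Cl, Finset.mem_insert, exists_eq_or_imp]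
    have : ¬ (p m).1 = x := fun e => hx e.symm
    simp [this]
  have c3 : ∀ a, Cl p S (p m).1 a ↔ a = (p m).1 := by
    intro a
    simp only [Cl, or_iff_left_iff_imp]
    rintro ⟨k, hk, h, -⟩
    exact absurd h (hq k hk).1
  have c4 : ∀ a, Cl p S (p m).2 a ↔ a = (p m).2 := by
    intro a
    simp only [Cl, or_iff_left_iff_imp]
    rintro ⟨k, hk, h, -⟩
    exact absurd h (hq k hk).2.1
  have oku := (h.verts _).1 hu
  have okv := (h.verts _).1 hv
  have cself : ∀ x, Cl p S x x := fun x => Or.inl rfl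
  constructor
  · show (H.verts.erase _).card + _ = _
    rw [Finset.card_erase_of_mem hv, Finset.card_insert_of_notMem hmS, ← h.card]
    have := Finset.card_pos.2 ⟨_, hv⟩
    omega
  · intro x
    show x ∈ H.verts.erase _ ↔ _
    rw [Finset.mem_erase, h.verts, ok]
  · have main : ∀ y, y ≠ (p m).1 → ((H.contract (p m).1 (p m).2).Black (p m).1 y ↔
        BlackS G p (insert m S) (p m).1 y) := by
      intro y hy
      simp only [Trigraph.contract, Finset.mem_erase, h.verts, h.black, BlackS, ok]
      simp only [c1, c2 _ _ hy, c3, c4]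
      grind
    have symB : ∀ x y, BlackS G p (insert m S) x y → BlackS G p (insert m S) y x :=
      fun x y ⟨h1, h2, h3, h4⟩ => ⟨h2, h1, h3.symm, fun a b ha hb => (h4 b a hb ha).symm⟩
    intro x y
    by_cases hx : x = (p m).1
    · subst hx
      by_cases hy : y = (p m).1
      · subst hy
        exact ⟨fun h => absurd rfl (Trigraph.black_ne _ _ _ h), fun h => absurd rfl h.2.2.1⟩
      · exact main y hy
    · by_cases hy : y = (p m).1
      · subst hy
        exact ⟨fun h => symB _ _ ((main x hx).1 (Trigraph.black_symm _ _ _ h)),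
          fun h => Trigraph.black_symm _ _ _ ((main x hx).2 (symB _ _ h))⟩
      · simp only [Trigraph.contract, Finset.mem_erase, h.verts, h.black, BlackS, ok]
        simp only [c2 _ _ hx, c2 _ _ hy]
        grind
  · have main : ∀ y, y ≠ (p m).1 → ((H.contract (p m).1 (p m).2).Red (p m).1 y ↔
        RedS G p (insert m S) (p m).1 y) := by
      intro y hy
      simp only [Trigraph.contract, Trigraph.Adj, Finset.mem_erase, h.verts, h.black, h.red,
        BlackS, RedS, ok]
      simp only [c1, c2 _ _ hy, c3, c4]
      have hy' : (p m).1 ≠ y := hy.symm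
      have hcy := cself y
      by_cases hyv : y = (p m).2
      · simp [hyv]
      have hyv' : (p m).2 ≠ y := fun e => hyv e.symm
      by_cases hoy : Ok p S y
      swap
      · simp [hoy]
      simp only [hne, hyv, hyv', hy, hy', hoy, oku, okv, ne_eq, not_false_eq_true, true_and,
        false_and, or_false, exists_and_left, exists_eq_left, forall_eq, not_true_eq_false]
      simp only [or_and_right, exists_or, exists_eq_left, forall_eq, not_and_or, not_forall]
      by_cases a1 : ∃ b, Cl p S y b ∧ G.Adj (p m).1 b <;>
      by_cases a2 : ∃ b, Cl p S y b ∧ G.Adj (p m).2 b <;>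
      by_cases a3 : ∃ b, Cl p S y b ∧ ¬ G.Adj (p m).1 b <;>
      by_cases a4 : ∃ b, Cl p S y b ∧ ¬ G.Adj (p m).2 b <;>
      grind
    have symR : ∀ x y, RedS G p (insert m S) x y → RedS G p (insert m S) y x :=
      fun x y ⟨h1, h2, h3, ⟨a, b, ha, hb, hab⟩, ⟨a', b', ha', hb', hab'⟩⟩ =>
        ⟨h2, h1, h3.symm, ⟨b, a, hb, ha, hab.symm⟩, ⟨b', a', hb', ha', fun e => hab' e.symm⟩⟩
    intro x y
    by_cases hx : x = (p m).1
    · subst hx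
      by_cases hy : y = (p m).1
      · subst hy
        exact ⟨fun h => absurd rfl (Trigraph.red_ne _ _ _ h), fun h => absurd rfl h.2.2.1⟩
      · exact main y hy
    · by_cases hy : y = (p m).1
      · subst hy
        exact ⟨fun h => symR _ _ ((main x hx).1 (Trigraph.red_symm _ _ _ h)),
          fun h => Trigraph.red_symm _ _ _ ((main x hx).2 (symR _ _ h))⟩
      · simp only [Trigraph.contract, Trigraph.Adj, Finset.mem_erase, h.verts, h.black, h.red,
          BlackS, RedS, ok]
        simp only [c2 _ _ hx, c2 _ _ hy]
        grind

open Classical in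
noncomputable def N (G : SimpleGraph V) (p : ℕ → V × V) (S : Finset ℕ) (u : V) : ℤ :=
  ∑ y, if RedS G p S u y then 1 else 0

theorem Rep.redDeg {S : Finset ℕ} {H : Trigraph V} (h : Rep G p S H) (u : V) :
    (H.redDeg u : ℤ) = N G p S u := by
  classical
  have : {w | H.Red u w} = ((Finset.univ.filter fun w => RedS G p S u w : Finset V) : Set V) := by
    ext w; simp [h.red]
  rw [Trigraph.redDeg, this, Set.ncard_coe_finset, N]
  simp

theorem N_diff (hp : Pairs s p) {S : Finset ℕ} (hS : S ⊆ Finset.Icc 1 s) {m i : ℕ}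
    (hm : m ∈ Finset.Icc 1 s) (hmS : m ∉ S) (hi : i ∈ S) :
    N G p (insert m S) (p i).1 - N G p S (p i).1 =
      N G p (insert m {i}) (p i).1 - N G p {i} (p i).1 := by
  classical
  obtain ⟨hp1, hp2⟩ := hp
  have him : i ≠ m := fun e => hmS (e ▸ hi)
  have cu : ∀ T : Finset ℕ, T ⊆ Finset.Icc 1 s → i ∈ T → ∀ a, Cl p T (p i).1 a ↔
      a = (p i).1 ∨ a = (p i).2 := by
    intro T hT hiT a
    constructor
    · rintro (h | ⟨k, hk, h1, h2⟩)
      · exact Or.inl h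
      · by_cases e : k = i
        · subst e; exact Or.inr h2.symm
        · exact absurd h1 (hp2 k (hT hk) i (hT hiT) e).1
    · rintro (h | h)
      · exact Or.inl h
      · exact Or.inr ⟨i, hiT, rfl, h.symm⟩
  have oku : ∀ T : Finset ℕ, T ⊆ Finset.Icc 1 s → i ∈ T → Ok p T (p i).1 := by
    intro T hT hiT k hk
    by_cases e : k = i
    · subst e; exact hp1 _ (hT hk)
    · exact (hp2 i (hT hiT) k (hT hk) (Ne.symm e)).2.1
  have hiI := hS hi
  have h1 : insert m S ⊆ Finset.Icc 1 s := Finset.insert_subset hm hS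
  have h2 : ({i} : Finset ℕ) ⊆ Finset.Icc 1 s := by simpa using hiI
  have h3 : insert m ({i} : Finset ℕ) ⊆ Finset.Icc 1 s := Finset.insert_subset hm h2
  have i1 : i ∈ insert m S := Finset.mem_insert_of_mem hi
  have i2 : i ∈ ({i} : Finset ℕ) := by simp
  have i3 : i ∈ insert m ({i} : Finset ℕ) := by simp
  -- locality
  have loc : ∀ T T' : Finset ℕ, T ⊆ Finset.Icc 1 s → i ∈ T → T' ⊆ Finset.Icc 1 s → i ∈ T' →
      ∀ y, (Ok p T y ↔ Ok p T' y) → (∀ a, Cl p T y a ↔ Cl p T' y a) →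
      (RedS G p T (p i).1 y ↔ RedS G p T' (p i).1 y) := by
    intro T T' hT hiT hT' hiT' y e1 e2
    simp only [RedS, cu T hT hiT, cu T' hT' hiT', e1, e2, oku T hT hiT, oku T' hT' hiT']
  unfold N
  rw [← Finset.sum_sub_distrib, ← Finset.sum_sub_distrib]
  refine Finset.sum_congr rfl fun y _ => ?_
  have hpm : ∀ T : Finset ℕ, T ⊆ Finset.Icc 1 s → ∀ k ∈ T, k ≠ m →
      (p k).1 ≠ (p m).1 ∧ (p k).1 ≠ (p m).2 ∧ (p k).2 ≠ (p m).1 ∧ (p k).2 ≠ (p m).2 :=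
    fun T hT k hk e => hp2 k (hT hk) m hm e
  have hne := hp1 m hm
  have hSm : ∀ k ∈ S, k ≠ m := fun k hk e => hmS (e ▸ hk)
  by_cases hy : y = (p m).1 ∨ y = (p m).2
  · have e1 := loc _ _ h1 i1 h3 i3 y
      (by
        have := hpm S hS
        have := hpm {i} h2 i (by simp) him
        simp only [Ok, Finset.mem_insert, Finset.mem_singleton]
        grind)
      (by
        have := hpm S hS
        have := hpm {i} h2 i (by simp) him
        intro a
        simp only [Cl, Finset.mem_insert, Finset.mem_singleton]
        grind)
    have e2 := loc _ _ hS hi h2 i2 y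
      (by
        have := hpm S hS
        have := hpm {i} h2 i (by simp) him
        simp only [Ok, Finset.mem_singleton]
        grind)
      (by
        have := hpm S hS
        have := hpm {i} h2 i (by simp) him
        intro a
        simp only [Cl, Finset.mem_singleton]
        grind)
    exact congrArg₂ (fun a b : ℤ => a - b) (if_congr e1 rfl rfl) (if_congr e2 rfl rfl)
  · have g : ∀ T : Finset ℕ, (Ok p (insert m T) y ↔ Ok p T y) ∧
        (∀ a, Cl p (insert m T) y a ↔ Cl p T y a) := by
      intro T
      push Not at hy
      refine ⟨by simp [Ok, hy.2], fun a => ?_⟩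
      have : ¬ (p m).1 = y := fun e => hy.1 e.symm
      simp [Cl, this]
    have e1 := loc _ _ h1 i1 hS hi y (g S).1 (g S).2
    have e2 := loc _ _ h3 i3 h2 i2 y (g {i}).1 (g {i}).2
    exact (sub_eq_zero.2 (if_congr e1 rfl rfl)).trans (sub_eq_zero.2 (if_congr e2 rfl rfl)).symm

theorem N_sum (hp : Pairs s p) {i : ℕ} (hi : i ∈ Finset.Icc 1 s) (S : Finset ℕ) :
    S ⊆ Finset.Icc 1 s → i ∉ S → N G p (insert i S) (p i).1 = N G p {i} (p i).1 +
      ∑ k ∈ S, (N G p (insert k {i}) (p i).1 - N G p {i} (p i).1) := by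
  induction S using Finset.induction_on with
  | empty => intro _ _; simp
  | insert m S hm ih =>
    intro hS hiS
    have hS' := (Finset.subset_insert m S).trans hS
    have hiS' : i ∉ S := fun h => hiS (Finset.mem_insert_of_mem h)
    have hmI := hS (Finset.mem_insert_self m S)
    have hmi : m ≠ i := fun e => hiS (e ▸ Finset.mem_insert_self m S)
    have := N_diff (G := G) hp (Finset.insert_subset hi hS') hmI (m := m) (i := i)
      (by simp [hm, hmi]) (Finset.mem_insert_self i S)
    rw [Finset.sum_insert hm, Finset.insert_comm]
    have := ih hS' hiS'
    linarith

theorem Rep.redDeg_le {S : Finset ℕ} {H : Trigraph V} (h : Rep G p S H) (u : V)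
    (hu : ∀ k ∈ S, (p k).1 ≠ u) : H.redDeg u ≤ S.card := by
  refine le_trans ?_ (Finset.card_image_le (s := S) (f := fun k => (p k).1))
  rw [Trigraph.redDeg, ← Set.ncard_coe_finset]
  apply Set.ncard_le_ncard _ (Finset.finite_toSet _)
  intro w hw
  have hw := (h.red _ _).1 hw
  by_contra hc
  have hc : ∀ k ∈ S, (p k).1 ≠ w := by simpa using hc
  obtain ⟨-, -, -, ⟨a, b, ha, hb, hab⟩, ⟨a', b', ha', hb', hab'⟩⟩ := hw
  have key : ∀ z a, (∀ k ∈ S, (p k).1 ≠ z) → Cl p S z a → a = z := by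
    rintro z a hz (h | ⟨k, hk, h, -⟩)
    · exact h
    · exact absurd h (hz k hk)
  rw [key u a hu ha, key w b hc hb] at hab
  rw [key u a' hu ha', key w b' hc hb'] at hab'
  exact hab' hab

theorem two_s_le (hp : Pairs s p) : 2 * s ≤ Fintype.card V := by
  obtain ⟨hp1, hp2⟩ := hp
  have c1 : ((Finset.Icc 1 s).image fun k => (p k).1).card = s := by
    rw [Finset.card_image_of_injOn]
    · simp
    · intro a ha b hb e
      by_contra hc
      exact (hp2 a (by simpa using ha) b (by simpa using hb) hc).1 e
  have c2 : ((Finset.Icc 1 s).image fun k => (p k).2).card = s := by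
    rw [Finset.card_image_of_injOn]
    · simp
    · intro a ha b hb e
      by_contra hc
      exact (hp2 a (by simpa using ha) b (by simpa using hb) hc).2.2.2 e
  have dj : Disjoint ((Finset.Icc 1 s).image fun k => (p k).1)
      ((Finset.Icc 1 s).image fun k => (p k).2) := by
    rw [Finset.disjoint_left]
    intro a ha hb
    obtain ⟨k, hk, rfl⟩ := Finset.mem_image.1 ha
    obtain ⟨l, hl, e⟩ := Finset.mem_image.1 hb
    by_cases hc : k = l
    · subst hc; exact hp1 _ hk e.symm
    · exact (hp2 k hk l hl hc).2.1 e.symm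
  have := Finset.card_le_univ (((Finset.Icc 1 s).image fun k => (p k).1) ∪
      ((Finset.Icc 1 s).image fun k => (p k).2))
  rw [Finset.card_union_of_disjoint dj, c1, c2] at this
  omega

end TwwAux



/-- **Lemma 4.4.** Let `G` be a graph on `n ≥ 2` vertices and `p 1, …, p s` pairwise disjoint
pairs of distinct vertices. For `i ∈ [s]` let `v_i` be the new vertex of `G/p_i` (here
identified with `(p i).1`) and let `x i j = rdeg_{G/p_i/p_j}(v_i) − rdeg_{G/p_i}(v_i)` for
`i ≠ j` and `x i i = 0`. Then `tww(G)` is at most the maximum of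
`{n−s−1} ∪ { rdeg_{G/p_i}(v_i) + Σ_{k=1}^{j} x i k : 1 ≤ i ≤ j ≤ s−1 }`; equivalently,
`tww(G) ≤ d` for every common upper bound `d` of that set. -/
theorem tww_le_of_contraction_pairs {V : Type*} [Fintype V] [DecidableEq V]
    (G : SimpleGraph V) (n : ℕ) (hn : Fintype.card V = n) (h2 : 2 ≤ n)
    (s : ℕ) (p : ℕ → V × V)
    (hne : ∀ i ∈ Finset.Icc 1 s, (p i).1 ≠ (p i).2)
    (hdisj : ∀ i ∈ Finset.Icc 1 s, ∀ j ∈ Finset.Icc 1 s, i ≠ j →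
      ({(p i).1, (p i).2} : Set V) ∩ {(p j).1, (p j).2} = ∅)
    (x : ℕ → ℕ → ℤ)
    (hx : ∀ i ∈ Finset.Icc 1 s, ∀ j ∈ Finset.Icc 1 s, x i j =
      if i = j then 0 else
        (((G.toTrigraph.contract (p i).1 (p i).2).contract (p j).1 (p j).2).redDeg
            (p i).1 : ℤ)
          - ((G.toTrigraph.contract (p i).1 (p i).2).redDeg (p i).1 : ℤ))
    (d : ℤ)
    (hd1 : (n : ℤ) - s - 1 ≤ d)
    (hd2 : ∀ i j : ℕ, 1 ≤ i → i ≤ j → j ≤ s - 1 →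
      ((G.toTrigraph.contract (p i).1 (p i).2).redDeg (p i).1 : ℤ)
        + ∑ k ∈ Finset.Icc 1 j, x i k ≤ d) :
    (G.tww : ℤ) ≤ d := by
  classical
  have hp : TwwAux.Pairs s p := by
    refine ⟨hne, fun i hi j hj hij => ?_⟩
    have h := hdisj i hi j hj hij
    have h' : ∀ z, (z = (p i).1 ∨ z = (p i).2) → (z = (p j).1 ∨ z = (p j).2) → False := by
      intro z h1 h2
      have : z ∈ ({(p i).1, (p i).2} : Set V) ∩ {(p j).1, (p j).2} := ⟨by simpa using h1, by simpa using h2⟩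
      rw [h] at this
      exact this
    exact ⟨fun e => h' _ (Or.inl rfl) (Or.inl e), fun e => h' _ (Or.inl rfl) (Or.inr e),
      fun e => h' _ (Or.inr rfl) (Or.inl e), fun e => h' _ (Or.inr rfl) (Or.inr e)⟩
  have h2s := TwwAux.two_s_le hp
  rw [hn] at h2s
  obtain ⟨D, rfl⟩ : ∃ D : ℕ, d = D := ⟨d.toNat, by omega⟩
  have rep1 : ∀ i ∈ Finset.Icc 1 s, TwwAux.Rep G p {i} (G.toTrigraph.contract (p i).1 (p i).2) := by
    intro i hi
    have := (TwwAux.rep_empty G p).contract hp (by simp) hi (by simp)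
    simpa using this
  have rep2 : ∀ i ∈ Finset.Icc 1 s, ∀ j ∈ Finset.Icc 1 s, j ≠ i →
      TwwAux.Rep G p (insert j {i})
        ((G.toTrigraph.contract (p i).1 (p i).2).contract (p j).1 (p j).2) := by
    intro i hi j hj hij
    exact (rep1 i hi).contract hp (by simpa using hi) hj (by simpa using hij)
  have bound : ∀ j, j + 1 ≤ s → ∀ H, TwwAux.Rep G p (Finset.Icc 1 j) H → ∀ v, H.redDeg v ≤ D := by
    intro j hj H hH v
    by_cases hv : ∃ i ∈ Finset.Icc 1 j, (p i).1 = v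
    · obtain ⟨i, hi, rfl⟩ := hv
      have hi' := Finset.mem_Icc.1 hi
      have hsub : Finset.Icc 1 j ⊆ Finset.Icc 1 s := Finset.Icc_subset_Icc_right (by omega)
      have hiI := hsub hi
      have hb := hd2 i j hi'.1 hi'.2 (by omega)
      rw [← Finset.add_sum_erase _ _ hi, hx i hiI i hiI, if_pos rfl, zero_add,
        (rep1 i hiI).redDeg] at hb
      have hs := TwwAux.N_sum (G := G) hp hiI ((Finset.Icc 1 j).erase i)
        ((Finset.erase_subset _ _).trans hsub) (by simp)
      rw [Finset.insert_erase hi, ← hH.redDeg] at hs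
      have : ∑ k ∈ (Finset.Icc 1 j).erase i, x i k = ∑ k ∈ (Finset.Icc 1 j).erase i,
          (TwwAux.N G p (insert k {i}) (p i).1 - TwwAux.N G p {i} (p i).1) := by
        refine Finset.sum_congr rfl fun k hk => ?_
        obtain ⟨hki, hk⟩ := Finset.mem_erase.1 hk
        rw [hx i hiI k (hsub hk), if_neg (Ne.symm hki), (rep1 i hiI).redDeg,
          (rep2 i hiI k (hsub hk) hki).redDeg]
      rw [this, ← hs] at hb
      exact_mod_cast hb
    · push Not at hv
      have := hH.redDeg_le v hv
      rw [Nat.card_Icc] at this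
      omega
  have main : ∀ t j, j + t = s → ∀ H, TwwAux.Rep G p (Finset.Icc 1 j) H → TwwAux.Good H D := by
    intro t
    induction t with
    | zero =>
      intro j hj H hH
      have := hH.card
      rw [Nat.card_Icc] at this
      exact TwwAux.good_small (n - s - 1) D (by omega) H (by omega)
    | succ t ih =>
      intro j hj H hH
      have hm : j + 1 ∈ Finset.Icc 1 s := Finset.mem_Icc.2 ⟨by omega, by omega⟩
      have hsub : Finset.Icc 1 j ⊆ Finset.Icc 1 s := Finset.Icc_subset_Icc_right (by omega)
      have hc := hH.contract hp hsub hm (by simp)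
      have hins : insert (j + 1) (Finset.Icc 1 j) = Finset.Icc 1 (j + 1) := by
        ext a
        simp only [Finset.mem_insert, Finset.mem_Icc]
        omega
      rw [hins] at hc
      refine TwwAux.good_step H D (p (j + 1)).1 (p (j + 1)).2 ?_ ?_ (hne _ hm)
        (bound j (by omega) H hH) (ih (j + 1) (by omega) _ hc)
      · rw [hH.verts]
        intro k hk
        exact (hp.2 (j + 1) hm k (hsub hk) (by have := Finset.mem_Icc.1 hk; omega)).2.1
      · rw [hH.verts]
        intro k hk
        exact (hp.2 (j + 1) hm k (hsub hk) (by have := Finset.mem_Icc.1 hk; omega)).2.2.2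
  have hg := main s 0 (by omega) G.toTrigraph (by simpa using TwwAux.rep_empty G p)
  have : G.tww ≤ D := Nat.sInf_le hg
  exact_mod_cast this
end

section
/- Let a_1, ..., a_n be nonnegative real numbers with average d = (Σ_{i=1}^n a_i)/n, and let k be a positive real number. Then there exist a subset R of [n] with |R| < k and a partition {B_1, ..., B_{k'}} of [n] \ R such that k' ≤ ⌈k⌉ and Σ_{j ∈ B_i} a_j ≤ dn/k for each i ∈ [k']. -/
open Finset in
lemma greedy_aux (a : ℕ → ℝ) (M : ℝ) (hM : 0 ≤ M) (S : Finset ℕ) (ha : ∀ i ∈ S, 0 ≤ a i) :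
    ∃ (R : Finset ℕ) (f : ℕ → ℕ), R ⊆ S ∧ (∀ j ∈ S \ R, f j ≤ R.card) ∧
      (∀ i, ∑ j ∈ (S \ R).filter (fun j => f j = i), a j ≤ M) ∧
      R.card * M + ∑ j ∈ (S \ R).filter (fun j => f j = R.card), a j ≤ ∑ j ∈ S, a j ∧
      (R.card ≠ 0 → R.card * M < ∑ j ∈ S, a j) := by
  induction S using Finset.induction_on with
  | empty => exact ⟨∅, id, by simp, by simp, by simpa using hM, by simp, by simp⟩
  | insert x S hx ih =>
    obtain ⟨R, f, hRS, hf, hs, ht, hlt⟩ := ih (fun i hi => ha i (mem_insert_of_mem hi))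
    have hxR : x ∉ R := fun h => hx (hRS h)
    have hax := ha x (mem_insert_self _ _)
    by_cases hc : ∑ j ∈ (S \ R).filter (fun j => f j = R.card), a j + a x ≤ M
    · have hxT : x ∉ S \ R := fun h => hx (mem_sdiff.1 h).1
      have key : ∀ i, ∑ j ∈ (insert x S \ R).filter (fun j => Function.update f x R.card j = i), a j
          = (if R.card = i then a x else 0) + ∑ j ∈ (S \ R).filter (fun j => f j = i), a j := by
        intro i
        rw [insert_sdiff_of_notMem _ hxR, sum_filter, sum_insert hxT, sum_filter]
        congr 1
        · simp
        · refine sum_congr rfl fun j hj => ?_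
          have : j ≠ x := fun h => hxT (h ▸ hj)
          simp [Function.update_of_ne this]
      refine ⟨R, Function.update f x R.card, hRS.trans (subset_insert _ _), ?_, ?_, ?_, ?_⟩
      · intro j hj
        by_cases h : j = x
        · simp [h]
        · rw [Function.update_of_ne h]
          apply hf
          simp_all
      · intro i
        rw [key]
        split_ifs with h
        · subst h; linarith
        · simpa using hs i
      · rw [key, sum_insert hx]
        simp only [if_true]
        linarith
      · intro h
        rw [sum_insert hx]
        linarith [hlt h]
    · have hT : insert x S \ insert x R = S \ R := by
        ext j
        simp only [mem_sdiff, mem_insert]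
        by_cases h : j = x <;> simp_all
      have hcard : (insert x R).card = R.card + 1 := card_insert_of_notMem hxR
      have h0 : (S \ R).filter (fun j => f j = R.card + 1) = ∅ := by
        rw [filter_eq_empty_iff]
        intro j hj
        have := hf j hj
        omega
      refine ⟨insert x R, f, insert_subset_insert _ hRS, ?_, ?_, ?_, ?_⟩
      · rw [hT, hcard]
        intro j hj
        exact (hf j hj).trans (Nat.le_succ _)
      · rw [hT]; exact hs
      · rw [hT, hcard, h0, sum_insert hx]
        push_cast
        simp only [sum_empty]
        linarith
      · intro _
        rw [hcard, sum_insert hx]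
        push_cast
        linarith


/-- **Lemma 5.1.** Let `a 1, …, a n` be nonnegative reals with average `d` and let `k > 0`
be real. Then there are a set `R ⊆ [n]` with `|R| < k` and a partition `{B 1, …, B k'}` of
`[n] \ R` with `k' ≤ ⌈k⌉` and `Σ_{j ∈ B i} a j ≤ dn/k` for each `i ∈ [k']`. -/
theorem exists_partition_small_sums (n : ℕ) (a : ℕ → ℝ)
    (ha : ∀ i ∈ Finset.Icc 1 n, 0 ≤ a i)
    (d : ℝ) (hd : d = (∑ i ∈ Finset.Icc 1 n, a i) / n) (k : ℝ) (hk : 0 < k) :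
    ∃ (R : Finset ℕ) (k' : ℕ) (B : ℕ → Finset ℕ),
      R ⊆ Finset.Icc 1 n ∧ (R.card : ℝ) < k ∧ (k' : ℝ) ≤ ⌈k⌉₊ ∧
      (∀ i ∈ Finset.Icc 1 k', B i ≠ ∅) ∧
      (∀ i ∈ Finset.Icc 1 k', ∀ j ∈ Finset.Icc 1 k', i ≠ j → Disjoint (B i) (B j)) ∧
      (Finset.Icc 1 n \ R = (Finset.Icc 1 k').biUnion B) ∧
      (∀ i ∈ Finset.Icc 1 k', ∑ j ∈ B i, a j ≤ d * n / k) := by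
  have hsum : d * n = ∑ i ∈ Finset.Icc 1 n, a i := by
    rcases Nat.eq_zero_or_pos n with rfl | hn
    · simp
    · have : (n : ℝ) ≠ 0 := by positivity
      rw [hd]; field_simp
  have hM : 0 ≤ d * n / k := by
    rw [hsum]; exact div_nonneg (Finset.sum_nonneg ha) hk.le
  obtain ⟨R, f, hRS, hf, hs, ht, hlt⟩ := greedy_aux a _ hM _ ha
  have hRk : (R.card : ℝ) < k := by
    by_cases h : R.card = 0
    · rw [h]; simpa using hk
    · have h1 := hlt h
      rw [← hsum] at h1
      by_contra hcon
      push Not at hcon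
      have h2 : k * (d * n / k) = d * n := by field_simp
      have h3 := mul_le_mul_of_nonneg_right hcon hM
      linarith
  set P := (Finset.Icc 1 n \ R).image f with hP
  have hPc : P.card ≤ R.card + 1 := by
    have : P ⊆ Finset.range (R.card + 1) := by
      intro y hy
      obtain ⟨j, hj, rfl⟩ := Finset.mem_image.1 hy
      exact Finset.mem_range.2 (Nat.lt_succ_of_le (hf j hj))
    simpa using Finset.card_le_card this
  have hceil : R.card + 1 ≤ ⌈k⌉₊ := Nat.lt_ceil.2 hRk
  obtain ⟨g, hg⟩ : ∃ g : ℕ → ℕ, Set.BijOn g (Finset.Icc 1 P.card : Finset ℕ) (P : Finset ℕ) := by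
    have : (Finset.Icc 1 P.card).card = P.card := by simp
    exact (Finset.finite_toSet _).exists_bijOn_of_encard_eq (by rw [Set.encard_coe_eq_coe_finsetCard, Set.encard_coe_eq_coe_finsetCard, this])
  refine ⟨R, P.card, fun i => (Finset.Icc 1 n \ R).filter (fun j => f j = g i), hRS, hRk,
    by exact_mod_cast hPc.trans hceil, ?_, ?_, ?_, fun i _ => hs (g i)⟩
  · intro i hi
    obtain ⟨j, hj, hji⟩ := Finset.mem_image.1 (Finset.mem_coe.1 (hg.mapsTo (Finset.mem_coe.2 hi)))
    exact Finset.nonempty_iff_ne_empty.1 ⟨j, Finset.mem_filter.2 ⟨hj, hji⟩⟩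
  · intro i hi j hj hij
    rw [Finset.disjoint_left]
    intro x hx hy
    exact hij (hg.injOn (Finset.mem_coe.2 hi) (Finset.mem_coe.2 hj)
      ((Finset.mem_filter.1 hx).2.symm.trans (Finset.mem_filter.1 hy).2))
  · ext x
    rw [Finset.mem_biUnion]
    constructor
    · intro hx
      obtain ⟨i, hi, hix⟩ := hg.surjOn (Finset.mem_coe.2 (Finset.mem_image_of_mem f hx))
      exact ⟨i, Finset.mem_coe.1 hi, Finset.mem_filter.2 ⟨hx, hix.symm⟩⟩
    · rintro ⟨i, _, hx⟩
      exact (Finset.mem_filter.1 hx).1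
end
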